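/- There exists a finite family Γ of Jordan curves in general position that is non-piercing and in which any two curves intersect in at most four points, together with a curve γ ∈ Γ and a point P ∈ γ̃ not lying on any curve of Γ, such that for every sweep F of Γ by γ to P there exist t ∈ [0,1) and α ∈ Γ ∖ {γ} for which the image of F(t,·) intersects the image of α in at least six points. -/

import Mathlib

noncomputable section

open Set Metric

abbrev Plane : Type := EuclideanSpace ℝ (Fin 2)

/-- The unit circle `S¹ ⊆ ℝ²`. -/
def unitCircle : Set Plane := Metric.sphere 0 1

/-- A Jordan curve: a continuous injective map from the unit circle to the plane. -/
structure JordanCurve : Type where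
  toFun : unitCircle → Plane
  continuous : Continuous toFun
  injective : Function.Injective toFun

/-- The image of a Jordan curve. -/
def JordanCurve.img (γ : JordanCurve) : Set Plane := Set.range γ.toFun

/-- The inside of (the image of) a map from the circle to the plane: the union of the
bounded connected components of the complement of its image. -/
def insideFun (f : unitCircle → Plane) : Set Plane :=
  {p | p ∉ Set.range f ∧ Bornology.IsBounded (connectedComponentIn (Set.range f)ᶜ p)}

/-- The inside of a Jordan curve. -/
def JordanCurve.inside (γ : JordanCurve) : Set Plane := insideFun γ.toFun

/-- Path-connectedness of a set (trivially true for the empty set). -/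
def PathConn (s : Set Plane) : Prop := ∀ x ∈ s, ∀ y ∈ s, JoinedIn s x y

/-- Two Jordan curves are non-piercing if each inside minus the other is path-connected. -/
def NonPiercing (α β : JordanCurve) : Prop :=
  PathConn (α.inside \ β.inside) ∧ PathConn (β.inside \ α.inside)

/-- A family of Jordan curves is non-piercing if its members are pairwise non-piercing. -/
def NonPiercingFamily (Γ : Set JordanCurve) : Prop :=
  ∀ α ∈ Γ, ∀ β ∈ Γ, α ≠ β → NonPiercing α β

/-- An intersection point `p` of two Jordan curves is a crossing: every neighbourhood of `p`
contains points of each curve inside the other, and points of each curve outside the closure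
of the inside of the other. -/
def IsCrossing (α β : JordanCurve) (p : Plane) : Prop :=
  ∀ U ∈ nhds p,
    (∃ q ∈ U, q ∈ α.img ∧ q ∈ β.inside) ∧
    (∃ q ∈ U, q ∈ α.img ∧ q ∉ closure β.inside) ∧
    (∃ q ∈ U, q ∈ β.img ∧ q ∈ α.inside) ∧
    (∃ q ∈ U, q ∈ β.img ∧ q ∉ closure α.inside)

/-- A finite family of Jordan curves is in general position: pairwise finite intersections,
all intersection points are crossings, and no point lies on three curves. -/
def GeneralPosition (Γ : Set JordanCurve) : Prop :=
  (∀ α ∈ Γ, ∀ β ∈ Γ, α ≠ β → (α.img ∩ β.img).Finite) ∧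
  (∀ α ∈ Γ, ∀ β ∈ Γ, α ≠ β → ∀ p ∈ α.img ∩ β.img, IsCrossing α β p) ∧
  (∀ α ∈ Γ, ∀ β ∈ Γ, ∀ δ ∈ Γ, ∀ p : Plane,
      p ∈ α.img → p ∈ β.img → p ∈ δ.img → α = β ∨ β = δ ∨ α = δ)

/-- A sweep of a family by the curve `γ` to the point `P ∈ γ̃`. -/
def IsSweep (γ : JordanCurve) (P : Plane) (F : ℝ → unitCircle → Plane) : Prop :=
  ContinuousOn (fun q : ℝ × unitCircle => F q.1 q.2) (Set.Icc 0 1 ×ˢ Set.univ) ∧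
  F 0 = γ.toFun ∧
  (∀ s, F 1 s = P) ∧
  (∀ t ∈ Set.Ico (0:ℝ) 1, Continuous (F t) ∧ Function.Injective (F t)) ∧
  (∀ s ∈ Set.Icc (0:ℝ) 1, ∀ t ∈ Set.Icc (0:ℝ) 1, s ≤ t →
      closure (insideFun (F t)) ⊆ closure (insideFun (F s))) ∧
  closure γ.inside ⊆ ⋃ t ∈ Set.Icc (0:ℝ) 1, Set.range (F t)

/-- The isometric identification of the plane with `ℂ`. -/
def toC : Plane ≃ₗᵢ[ℝ] ℂ := Complex.orthonormalBasisOneI.repr.symm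

/-- A complex-valued function has a continuous logarithm. -/
def HasLog {X : Type*} [TopologicalSpace X] (f : X → ℂ) : Prop :=
  ∃ g : X → ℂ, Continuous g ∧ ∀ x, Complex.exp (g x) = f x

theorem HasLog.of_norm_sub_lt {X : Type*} [TopologicalSpace X] {f f' : X → ℂ}
    (h : HasLog f) (hf : Continuous f) (hf' : Continuous f')
    (hlt : ∀ x, ‖f' x - f x‖ < ‖f x‖) : HasLog f' := by
  obtain ⟨g, hg, hgf⟩ := h
  have hne : ∀ x, f x ≠ 0 := fun x => hgf x ▸ Complex.exp_ne_zero _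
  have hslit : ∀ x, 1 + (f' x - f x) / f x ∈ Complex.slitPlane := fun x => by
    apply Complex.mem_slitPlane_of_norm_lt_one
    rw [norm_div, div_lt_one (norm_pos_iff.2 (hne x))]
    exact hlt x
  refine ⟨fun x => g x + Complex.log (1 + (f' x - f x) / f x), ?_, fun x => ?_⟩
  · refine hg.add (Continuous.clog ?_ hslit)
    exact continuous_const.add ((hf'.sub hf).div hf hne)
  · rw [Complex.exp_add, hgf, Complex.exp_log (Complex.slitPlane_ne_zero (hslit x))]
    field_simp [hne x]
    ring

theorem HasLog.congr {X : Type*} [TopologicalSpace X] {f f' : X → ℂ} (h : HasLog f)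
    (hff : ∀ x, f x = f' x) : HasLog f' :=
  funext hff ▸ h

theorem HasLog.mul_const {X : Type*} [TopologicalSpace X] {f : X → ℂ} (h : HasLog f) {c : ℂ}
    (hc : c ≠ 0) : HasLog fun x => f x * c := by
  obtain ⟨g, hg, hgf⟩ := h
  exact ⟨fun x => g x + Complex.log c, hg.add continuous_const, fun x => by
    rw [Complex.exp_add, hgf, Complex.exp_log hc]⟩

theorem HasLog.comp {X Y : Type*} [TopologicalSpace X] [TopologicalSpace Y] {f : X → ℂ}
    (h : HasLog f) {e : Y → X} (he : Continuous e) : HasLog fun y => f (e y) := by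
  obtain ⟨g, hg, hgf⟩ := h
  exact ⟨fun y => g (e y), hg.comp he, fun y => hgf _⟩

instance : PreconnectedSpace unitCircle :=
  Subtype.preconnectedSpace (isPreconnected_sphere (by
    rw [← Module.finrank_eq_rank, finrank_euclideanSpace_fin]; norm_num) 0 1)

instance : CompactSpace unitCircle := isCompact_iff_compactSpace.1 (isCompact_sphere 0 1)

instance : Nonempty unitCircle :=
  (NormedSpace.sphere_nonempty.2 zero_le_one : (sphere (0 : Plane) 1).Nonempty).to_subtype

/-- The identity of the circle has no continuous logarithm. -/
theorem not_hasLog_unitCircle : ¬ HasLog fun s : unitCircle => toC s := by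
  rintro ⟨g, hg, hgs⟩
  have hmem : ∀ s : unitCircle, -(s : Plane) ∈ unitCircle := fun s => by
    have := s.2
    simp only [unitCircle, mem_sphere_iff_norm, sub_zero, norm_neg] at this ⊢
    exact this
  let ν : unitCircle → unitCircle := fun s => ⟨-(s : Plane), hmem s⟩
  have hν : Continuous ν := by fun_prop
  have hνν : ∀ s, ν (ν s) = s := fun s => Subtype.ext (neg_neg _)
  let k : unitCircle → ℝ := fun s => (g s - g (ν s)).im
  have hk : Continuous k := by fun_prop
  have hne : ∀ s, k s ≠ 0 := fun s hs => by
    have h1 : Complex.exp (g s) = -Complex.exp (g (ν s)) := by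
      rw [hgs, hgs]; simp [ν]
    have h2 : Complex.exp (g s - g (ν s)) = -1 := by
      rw [Complex.exp_sub, h1, neg_div, div_self (Complex.exp_ne_zero _)]
    have h3 := congrArg Complex.re h2
    rw [Complex.exp_re, show (g s - g (ν s)).im = 0 from hs, Real.cos_zero, mul_one] at h3
    have := Real.exp_pos (g s - g (ν s)).re
    rw [h3] at this
    norm_num at this
  obtain ⟨s⟩ := (inferInstance : Nonempty unitCircle)
  have hodd : k (ν s) = -k s := by simp only [k, hνν]; simp
  have hmem0 : (0 : ℝ) ∈ range k := by
    rcases le_total (k s) 0 with h | h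
    · exact mem_range_of_exists_le_of_exists_ge hk ⟨s, h⟩ ⟨ν s, by linarith⟩
    · exact mem_range_of_exists_le_of_exists_ge hk ⟨ν s, by linarith⟩ ⟨s, h⟩
  obtain ⟨s, hs⟩ := hmem0
  exact hne s hs

/-- A nonvanishing continuous function on the plane has a continuous logarithm. -/
theorem hasLog_plane {φ : Plane → ℂ} (hφ : Continuous φ) (h0 : ∀ x, φ x ≠ 0) : HasLog φ := by
  obtain ⟨F, ⟨-, hF⟩, -⟩ := Complex.isCoveringMapOn_exp.existsUnique_continuousMap_lifts
    (A := Plane) ⟨φ, hφ⟩ (a₀ := 0) (Complex.exp_log (h0 0)) (fun x => h0 x)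
  exact ⟨F, F.continuous, fun x => congrFun hF x⟩

/-- A function equal to the translation by `q` off a bounded set vanishes somewhere. -/
theorem not_nonvanishing_of_eq_sub {φ : Plane → ℂ} (hφ : Continuous φ) (h0 : ∀ x, φ x ≠ 0)
    {U : Set Plane} (hU : Bornology.IsBounded U) {q : Plane} (h : ∀ x ∉ U, φ x = toC (x - q)) :
    False := by
  obtain ⟨r, hr⟩ := hU.subset_ball 0
  set R : ℝ := max r (2 * ‖q‖ + 1)
  have hRq : 2 * ‖q‖ < R := lt_of_lt_of_le (by linarith) (le_max_right _ _)
  have hR : 0 < R := lt_of_le_of_lt (by positivity) hRq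
  have hn : ∀ s : unitCircle, ‖R • (s : Plane)‖ = R := fun s => by
    have : ‖(s : Plane)‖ = 1 := by simpa [unitCircle] using s.2
    rw [norm_smul, this, mul_one, Real.norm_of_nonneg hR.le]
  have h1 : HasLog fun s : unitCircle => toC (R • (s : Plane) - q) :=
    ((hasLog_plane hφ h0).comp (e := fun s : unitCircle => R • (s : Plane)) (by fun_prop)).congr
      fun s => h _ fun hs => by
        have h2 := mem_ball_zero_iff.1 (hr hs)
        rw [hn] at h2
        exact absurd (le_max_left r (2 * ‖q‖ + 1)) (not_le.2 h2)
  have h2 : HasLog fun s : unitCircle => toC (R • (s : Plane)) := by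
    refine h1.of_norm_sub_lt (by fun_prop) (by fun_prop) fun s => ?_
    rw [← map_sub, LinearIsometryEquiv.norm_map, LinearIsometryEquiv.norm_map, sub_sub_cancel]
    have := norm_sub_norm_le (R • (s : Plane)) q
    rw [hn] at this
    linarith
  refine not_hasLog_unitCircle ((h2.mul_const (c := ((R : ℝ) : ℂ)⁻¹) (by simpa using hR.ne')).congr
    fun s => ?_)
  rw [map_smul, Complex.real_smul, mul_comm, ← mul_assoc,
    inv_mul_cancel₀ (by exact_mod_cast hR.ne'), one_mul]

/-- A curve has no logarithm about a point of its inside. -/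
theorem not_hasLog_of_mem_insideFun {f : unitCircle → Plane} (hf : Continuous f)
    (hinj : Function.Injective f) {q : Plane} (hq : q ∈ insideFun f) :
    ¬ HasLog fun s => toC (f s - q) := by
  classical
  rintro ⟨g, hg, hgs⟩
  obtain ⟨hqr, hb⟩ := hq
  have hemb : Topology.IsClosedEmbedding f := hf.isClosedEmbedding hinj
  obtain ⟨H, hH⟩ := ContinuousMap.exists_extension hemb (⟨g, hg⟩ : C(unitCircle, ℂ))
  have hcl : IsClosed (range f) := (isCompact_range hf).isClosed
  set U := connectedComponentIn (range f)ᶜ q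
  have hUo : IsOpen U := hcl.isOpen_compl.connectedComponentIn
  have hqU : q ∈ U := mem_connectedComponentIn hqr
  have hfr : ∀ a ∈ frontier U, a ∈ range f := fun a ha => by
    by_contra har
    rw [hUo.frontier_eq] at ha
    refine ha.2 ?_
    have hcon : IsPreconnected (insert a U) :=
      isPreconnected_connectedComponentIn.subset_closure (subset_insert _ _)
        (insert_subset ha.1 subset_closure)
    exact hcon.subset_connectedComponentIn (mem_insert_of_mem _ hqU)
      (insert_subset har (connectedComponentIn_subset _ _)) (mem_insert _ _)
  let φ : Plane → ℂ := U.piecewise (fun x => Complex.exp (H x)) fun x => toC (x - q)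
  have hφ : Continuous φ := by
    refine Continuous.piecewise (fun a ha => ?_) (by fun_prop) (by fun_prop)
    obtain ⟨s, rfl⟩ := hfr a ha
    exact (congrArg Complex.exp (DFunLike.congr_fun hH s)).trans (hgs s)
  have h0 : ∀ x, φ x ≠ 0 := fun x => by
    by_cases hx : x ∈ U
    · rw [show φ x = _ from piecewise_eq_of_mem _ _ _ hx]
      exact Complex.exp_ne_zero _
    · rw [show φ x = _ from piecewise_eq_of_notMem _ _ _ hx, Ne, map_eq_zero_iff _ toC.injective,
        sub_eq_zero]
      rintro rfl
      exact hx hqU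
  exact not_nonvanishing_of_eq_sub hφ h0 hb fun x hx => piecewise_eq_of_notMem _ _ _ hx

/-- Logarithms of a curve persist under small perturbation of curve and base point. -/
theorem hasLog_of_dist_lt {f f' : unitCircle → Plane} (hf : Continuous f) (hf' : Continuous f')
    {q q' : Plane} (h : HasLog fun s => toC (f s - q))
    (hlt : ∀ s, dist (f' s - q') (f s - q) < dist (f s) q) : HasLog fun s => toC (f' s - q') := by
  refine h.of_norm_sub_lt (by fun_prop) (by fun_prop) fun s => ?_
  rw [← map_sub, LinearIsometryEquiv.norm_map, LinearIsometryEquiv.norm_map, ← dist_eq_norm,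
    ← dist_eq_norm]
  exact hlt s

theorem hasLog_of_forall_norm_lt {f : unitCircle → Plane} (hf : Continuous f) {q : Plane}
    (h : ∀ s, ‖f s‖ < ‖q‖) : HasLog fun s => toC (f s - q) := by
  obtain ⟨s⟩ := (inferInstance : Nonempty unitCircle)
  have hq : q ≠ 0 := norm_pos_iff.1 ((norm_nonneg _).trans_lt (h s))
  have : HasLog fun _ : unitCircle => toC (0 - q) :=
    ⟨fun _ => Complex.log (toC (0 - q)), continuous_const, fun _ =>
      Complex.exp_log (by simpa [map_eq_zero_iff _ toC.injective] using hq)⟩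
  refine hasLog_of_dist_lt (f := fun _ => 0) continuous_const hf this fun s => ?_
  simpa using h s

/-- A curve has a logarithm about any point in an unbounded component of its complement. -/
theorem hasLog_of_notMem_insideFun {f : unitCircle → Plane} (hf : Continuous f) {q : Plane}
    (hqr : q ∉ range f) (hq : q ∉ insideFun f) : HasLog fun s => toC (f s - q) := by
  have hcl : IsClosed (range f) := (isCompact_range hf).isClosed
  have hne : (range f).Nonempty := range_nonempty f
  set U := connectedComponentIn (range f)ᶜ q
  have hUb : ¬ Bornology.IsBounded U := fun hb => hq ⟨hqr, hb⟩
  have hqU : q ∈ U := mem_connectedComponentIn hqr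
  have hlt : ∀ p p' : Plane, dist p p' < infDist p (range f) →
      HasLog (fun s => toC (f s - p)) → HasLog fun s => toC (f s - p') := fun p p' h hl =>
    hasLog_of_dist_lt hf hf hl fun s => by
      rw [dist_sub_left]
      rw [dist_comm p'] 
      exact h.trans_le (by rw [dist_comm (f s)]; exact infDist_le_dist_of_mem (mem_range_self s))
  set L : Set Plane := {p | p ∉ range f ∧ HasLog fun s => toC (f s - p)}
  set N : Set Plane := {p | p ∉ range f ∧ ¬ HasLog fun s => toC (f s - p)}
  have hnear : ∀ p ∉ range f, ∀ᶠ p' in nhds p, p' ∉ range f ∧ dist p p' < infDist p (range f) ∧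
      dist p' p < infDist p' (range f) := fun p hp => by
    have hpos := (hcl.notMem_iff_infDist_pos hne).1 hp
    refine Filter.Eventually.and (hcl.isOpen_compl.mem_nhds hp) (Filter.Eventually.and ?_ ?_)
    · exact (ContinuousAt.eventually_lt (by fun_prop) continuousAt_const (by simpa using hpos))
    · refine ContinuousAt.eventually_lt (by fun_prop)
        (continuous_infDist_pt _).continuousAt (by simpa using hpos)
  have hLo : IsOpen L := isOpen_iff_mem_nhds.2 fun p hp =>
    (hnear p hp.1).mono fun p' h => ⟨h.1, hlt p p' h.2.1 hp.2⟩
  have hNo : IsOpen N := isOpen_iff_mem_nhds.2 fun p hp =>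
    (hnear p hp.1).mono fun p' h => ⟨h.1, fun hl => hp.2 (hlt p' p h.2.2 hl)⟩
  obtain ⟨M, hM⟩ := (isCompact_range hf).isBounded.exists_norm_le
  obtain ⟨p, hpU, hp⟩ : ∃ p ∈ U, M < ‖p‖ := by
    by_contra! hcon
    exact hUb (isBounded_iff_forall_norm_le.2 ⟨M, hcon⟩)
  have hpL : HasLog fun s => toC (f s - p) :=
    hasLog_of_forall_norm_lt hf fun s => (hM _ (mem_range_self s)).trans_lt hp
  have hsub : U ⊆ L := by
    refine isPreconnected_connectedComponentIn.subset_left_of_subset_union hLo hNo ?_ ?_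
      ⟨p, hpU, connectedComponentIn_subset _ _ hpU, hpL⟩
    · exact disjoint_left.2 fun x hx hx' => hx'.2 hx.2
    · intro x hx
      have := connectedComponentIn_subset _ _ hx
      by_cases hl : HasLog fun s => toC (f s - x)
      · exact Or.inl ⟨this, hl⟩
      · exact Or.inr ⟨this, hl⟩
  exact (hsub hqU).2

theorem mem_insideFun_iff {f : unitCircle → Plane} (hf : Continuous f)
    (hinj : Function.Injective f) {q : Plane} (hq : q ∉ range f) :
    q ∈ insideFun f ↔ ¬ HasLog fun s => toC (f s - q) :=
  ⟨not_hasLog_of_mem_insideFun hf hinj, fun h => by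
    by_contra hc
    exact h (hasLog_of_notMem_insideFun hf hq hc)⟩

/-- Two points of a preconnected set missing the curve are on the same side of it. -/
theorem mem_insideFun_of_isPreconnected {f : unitCircle → Plane} {S : Set Plane}
    (hS : IsPreconnected S) (hSf : S ⊆ (range f)ᶜ) {p q : Plane} (hp : p ∈ S) (hq : q ∈ S)
    (hpi : p ∈ insideFun f) : q ∈ insideFun f := by
  have : q ∈ connectedComponentIn (range f)ᶜ p := hS.subset_connectedComponentIn hp hSf hq
  refine ⟨hSf hq, ?_⟩
  rw [← connectedComponentIn_eq this]
  exact hpi.2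

theorem mem_insideFun_of_mem_closure {f : unitCircle → Plane} (hf : Continuous f) {p : Plane}
    (hp : p ∈ closure (insideFun f)) (hpf : p ∉ range f) : p ∈ insideFun f := by
  have hcl : IsClosed (range f) := (isCompact_range hf).isClosed
  have ho : IsOpen (connectedComponentIn (range f)ᶜ p) := hcl.isOpen_compl.connectedComponentIn
  obtain ⟨q, hq, hqi⟩ := mem_closure_iff.1 hp _ ho (mem_connectedComponentIn hpf)
  exact mem_insideFun_of_isPreconnected isPreconnected_connectedComponentIn
    (connectedComponentIn_subset _ _) hq (mem_connectedComponentIn hpf) hqi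

/-- If the curve `f` has an inside at all, then it lies in the closure of that inside. -/
theorem range_subset_closure_insideFun {f : unitCircle → Plane} (hf : Continuous f)
    (hinj : Function.Injective f) (hne : (insideFun f).Nonempty) :
    range f ⊆ closure (insideFun f) := by
  classical
  rintro _ ⟨v, rfl⟩
  by_contra hv
  obtain ⟨q, hqr, hb⟩ := hne
  have hcl : IsClosed (range f) := (isCompact_range hf).isClosed
  set U := connectedComponentIn (range f)ᶜ q
  have hUo : IsOpen U := hcl.isOpen_compl.connectedComponentIn
  have hqU : q ∈ U := mem_connectedComponentIn hqr
  have hUi : U ⊆ insideFun f := fun x hx =>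
    mem_insideFun_of_isPreconnected isPreconnected_connectedComponentIn
      (connectedComponentIn_subset _ _) hqU hx ⟨hqr, hb⟩
  let A : Set unitCircle := f ⁻¹' closure (insideFun f)
  have hAc : IsClosed A := isClosed_closure.preimage hf
  have hvn : ‖(v : Plane)‖ = 1 := by simpa [unitCircle] using v.2
  have hemb : Topology.IsClosedEmbedding fun s : A => f s :=
    (hf.isClosedEmbedding hinj).comp hAc.isClosedEmbedding_subtypeVal
  let σ := stereographic hvn
  have hfσ : Continuous fun y : (Submodule.span ℝ {(v : Plane)})ᗮ => f (σ.symm y) :=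
    hf.comp (σ.continuousOn_symm.comp_continuous continuous_id fun y => by
      simp [σ])
  obtain ⟨G, ⟨-, hG⟩, -⟩ := Complex.isCoveringMapOn_exp.existsUnique_continuousMap_lifts
    (A := (Submodule.span ℝ {(v : Plane)})ᗮ) ⟨fun y => toC (f (σ.symm y) - q),
      toC.continuous.comp (hfσ.sub continuous_const)⟩
    (a₀ := 0) (e₀ := Complex.log (toC (f (σ.symm 0) - q)))
    (Complex.exp_log (by
      rw [Ne, map_eq_zero_iff _ toC.injective, sub_eq_zero]
      exact fun h => hqr ⟨_, h⟩)) (fun y => by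
      rw [mem_compl_singleton_iff, ContinuousMap.coe_mk, Ne, map_eq_zero_iff _ toC.injective,
        sub_eq_zero]
      exact fun h => hqr ⟨_, h⟩)
  have hAv : ∀ s : A, (s : unitCircle) ∈ σ.source := fun s => by
    have hs : σ.source = {v}ᶜ := stereographic_source hvn
    rw [hs]
    intro h
    have h2 := s.2
    rw [show (s : unitCircle) = v from h] at h2
    exact hv h2
  have hg : Continuous fun s : A => G (σ (s : unitCircle)) :=
    G.continuous.comp (σ.continuousOn.comp_continuous continuous_subtype_val hAv)
  obtain ⟨H, hH⟩ := ContinuousMap.exists_extension hemb (⟨_, hg⟩ : C(A, ℂ))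
  have hfr : ∀ a ∈ frontier U, ∃ s : A, f s = a := fun a ha => by
    have har : a ∈ range f := by
      by_contra har
      rw [hUo.frontier_eq] at ha
      refine ha.2 ?_
      have hcon : IsPreconnected (insert a U) :=
        isPreconnected_connectedComponentIn.subset_closure (subset_insert _ _)
          (insert_subset ha.1 subset_closure)
      exact hcon.subset_connectedComponentIn (mem_insert_of_mem _ hqU)
        (insert_subset har (connectedComponentIn_subset _ _)) (mem_insert _ _)
    obtain ⟨s, rfl⟩ := har
    exact ⟨⟨s, closure_mono hUi (frontier_subset_closure ha)⟩, rfl⟩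
  let φ : Plane → ℂ := U.piecewise (fun x => Complex.exp (H x)) fun x => toC (x - q)
  have hφ : Continuous φ := by
    refine Continuous.piecewise (fun a ha => ?_) (by fun_prop) (by fun_prop)
    obtain ⟨s, rfl⟩ := hfr a ha
    refine (congrArg Complex.exp (DFunLike.congr_fun hH s)).trans ((congrFun hG _).trans ?_)
    simp [σ.left_inv (hAv s)]
  have h0 : ∀ x, φ x ≠ 0 := fun x => by
    by_cases hx : x ∈ U
    · rw [show φ x = _ from piecewise_eq_of_mem _ _ _ hx]
      exact Complex.exp_ne_zero _
    · rw [show φ x = _ from piecewise_eq_of_notMem _ _ _ hx, Ne, map_eq_zero_iff _ toC.injective,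
        sub_eq_zero]
      rintro rfl
      exact hx hqU
  exact not_nonvanishing_of_eq_sub hφ h0 hb fun x hx => piecewise_eq_of_notMem _ _ _ hx

/-- A path from the inside of a curve to a point off the inside meets the curve. -/
theorem exists_mem_range_of_mem_insideFun {f : unitCircle → Plane} {c : ℝ → Plane}
    (hc : Continuous c) {a b : ℝ} (ha : c a ∈ insideFun f) (hb : c b ∉ insideFun f) :
    ∃ u ∈ uIcc a b, u ≠ a ∧ c u ∈ range f := by
  by_contra! hcon
  refine hb (mem_insideFun_of_isPreconnected
    (isPreconnected_uIcc.image c hc.continuousOn) ?_ (mem_image_of_mem c left_mem_uIcc)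
    (mem_image_of_mem c right_mem_uIcc) ha)
  rintro _ ⟨u, hu, rfl⟩
  by_cases h : u = a
  · exact h ▸ ha.1
  · exact hcon u hu h

section Sweep

variable {γ : JordanCurve} {P : Plane} {F : ℝ → unitCircle → Plane}

theorem IsSweep.continuous_apply (h : IsSweep γ P F) {t : ℝ} (ht : t ∈ Ico (0 : ℝ) 1) :
    Continuous (F t) := (h.2.2.2.1 t ht).1

theorem IsSweep.injective_apply (h : IsSweep γ P F) {t : ℝ} (ht : t ∈ Ico (0 : ℝ) 1) :
    Function.Injective (F t) := (h.2.2.2.1 t ht).2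

theorem IsSweep.eventually_dist_lt (h : IsSweep γ P F) {t₀ : ℝ} (ht : t₀ ∈ Icc (0 : ℝ) 1) {r : ℝ}
    (hr : 0 < r) : ∀ᶠ t in nhdsWithin t₀ (Icc 0 1), ∀ s, dist (F t s) (F t₀ s) < r := by
  obtain ⟨v, hv, hd⟩ := IsCompact.mem_uniformity_of_prod (f := F) isCompact_univ h.1 ht
    (dist_mem_uniformity hr)
  exact Filter.mem_of_superset hv fun t htv s => hd t htv s (mem_univ s)

/-- Away from the curve, being inside is locally constant in time. -/
theorem IsSweep.eventually_mem_insideFun_iff (h : IsSweep γ P F) {t₀ : ℝ}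
    (ht : t₀ ∈ Ico (0 : ℝ) 1) {q : Plane} (hq : q ∉ range (F t₀)) :
    ∀ᶠ t in nhdsWithin t₀ (Icc 0 1), t < 1 →
      q ∉ range (F t) ∧ (q ∈ insideFun (F t) ↔ q ∈ insideFun (F t₀)) := by
  have hc := h.continuous_apply ht
  have hcl : IsClosed (range (F t₀)) := (isCompact_range hc).isClosed
  have hpos := (hcl.notMem_iff_infDist_pos (range_nonempty _)).1 hq
  have hle : ∀ s, infDist q (range (F t₀)) ≤ dist (F t₀ s) q := fun s => by
    rw [dist_comm]; exact infDist_le_dist_of_mem (mem_range_self s)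
  filter_upwards [h.eventually_dist_lt ⟨ht.1, ht.2.le⟩ (half_pos hpos), self_mem_nhdsWithin]
    with t hd htI ht1
  have htI' : t ∈ Ico (0 : ℝ) 1 := ⟨htI.1, ht1⟩
  have hc' := h.continuous_apply htI'
  have hlt : ∀ s, dist (F t s) (F t₀ s) < dist (F t s) q := fun s => by
    linarith [hle s, hd s, dist_triangle_left (F t₀ s) q (F t s)]
  have hq' : q ∉ range (F t) := by
    rintro ⟨s, rfl⟩
    have := hlt s
    rw [dist_self] at this
    exact absurd this (not_lt.2 dist_nonneg)
  refine ⟨hq', ?_⟩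
  rw [mem_insideFun_iff hc' (h.injective_apply htI') hq',
    mem_insideFun_iff hc (h.injective_apply ht) hq, not_iff_not]
  constructor
  · refine fun hl => hasLog_of_dist_lt hc' hc hl fun s => ?_
    rw [dist_sub_right, dist_comm]
    exact hlt s
  · refine fun hl => hasLog_of_dist_lt hc hc' hl fun s => ?_
    rw [dist_sub_right]
    linarith [hle s, hd s]

/-- Every point other than the target is eventually left behind. -/
theorem IsSweep.eventually_notMem_closure (h : IsSweep γ P F) {q : Plane} (hq : q ≠ P) :
    ∀ᶠ t in nhdsWithin 1 (Icc 0 1), t < 1 → q ∉ closure (insideFun (F t)) := by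
  have hpos := half_pos (dist_pos.2 hq)
  filter_upwards [h.eventually_dist_lt ⟨zero_le_one, le_rfl⟩ hpos, self_mem_nhdsWithin]
    with t hd htI ht1 hcl
  have htI' : t ∈ Ico (0 : ℝ) 1 := ⟨htI.1, ht1⟩
  have hsub : insideFun (F t) ⊆ closedBall P (dist q P / 2) := fun p hp => by
    by_contra hcon
    rw [mem_closedBall, not_le] at hcon
    have hpP : p ≠ P := dist_pos.1 (hpos.trans hcon)
    refine not_hasLog_of_mem_insideFun (h.continuous_apply htI') (h.injective_apply htI') hp ?_
    have h0 : HasLog fun _ : unitCircle => toC (P - p) :=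
      ⟨fun _ => Complex.log (toC (P - p)), continuous_const, fun _ => Complex.exp_log (by
        rw [Ne, map_eq_zero_iff _ toC.injective, sub_eq_zero]; exact hpP.symm)⟩
    refine hasLog_of_dist_lt (f := fun _ => P) continuous_const (h.continuous_apply htI') h0
      fun s => ?_
    have := hd s
    rw [h.2.2.1] at this
    rw [dist_sub_right, dist_comm P p]
    linarith
  have := closure_minimal hsub isClosed_closedBall hcl
  rw [mem_closedBall] at this
  linarith

end Sweep

/-- A stretch of a parametrised curve: it enters the region of interest after `lo`, runs through
the vertices `first`, `mids`, `last`, and has left the region at `hi`. -/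
structure Chord where
  lo : ℕ
  first : ℕ
  mids : List ℕ
  last : ℕ
  hi : ℕ

/-- The vertices of a chord. -/
def Chord.vs (c : Chord) : List ℕ := c.first :: c.last :: c.mids

/-- The vertices of a chord are ordered as the names suggest. -/
def Chord.Ok (c : Chord) : Prop :=
  c.lo < c.first ∧ c.first < c.last ∧ c.last < c.hi ∧ ∀ m ∈ c.mids, c.first < m ∧ m < c.last

instance (c : Chord) : Decidable c.Ok := by unfold Chord.Ok; infer_instance

/-- A closed curve of length `n` with two chords; `code k` names the point at parameter `k`. -/
structure Track where
  n : ℕ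
  code : ℕ → ℕ
  left : Chord
  right : Chord

/-- The chords of a track are disjoint and properly ordered. -/
def Track.Ok (τ : Track) : Prop :=
  τ.left.Ok ∧ τ.right.Ok ∧ τ.left.hi < τ.right.lo ∧ τ.right.hi < τ.n

instance (τ : Track) : Decidable τ.Ok := by unfold Track.Ok; infer_instance

/-- The names of the middle vertices of a track. -/
def Track.mids (τ : Track) : List ℕ := (τ.left.mids ++ τ.right.mids).map τ.code

/-- The two orderings of the pair of chords of a track. -/
def Track.chords (τ : Track) : List (Chord × Chord) := [(τ.left, τ.right), (τ.right, τ.left)]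

/-- The names of all vertices of a list of tracks. -/
def verts (T : List Track) : List ℕ :=
  T.flatMap fun τ => (τ.left.vs ++ τ.right.vs).map τ.code

/-- Two different vertices are middle vertices of a common track. -/
def Excl (T : List Track) (p q : ℕ) : Prop := p ≠ q ∧ ∃ τ ∈ T, p ∈ τ.mids ∧ q ∈ τ.mids

instance (T : List Track) (p q : ℕ) : Decidable (Excl T p q) := by unfold Excl; infer_instance

/-- The combinatorial condition under which a vertex cannot be the first one passed by a sweep. -/
def Good (T : List Track) (v : ℕ) : Prop :=
  ∃ τ ∈ T, ∃ ab ∈ τ.chords, ∃ k ∈ ab.1.vs, τ.code k = v ∧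
    (∃ l ∈ ab.1.vs, l < k ∧ Excl T (τ.code l) v) ∧
    (∃ r ∈ ab.1.vs, k < r ∧ Excl T (τ.code r) v) ∧
    ∃ x ∈ ab.2.vs, ∃ y ∈ k :: ab.2.vs, Excl T (τ.code x) (τ.code y)

instance (T : List Track) (v : ℕ) : Decidable (Good T v) := by unfold Good; infer_instance

theorem Chord.Ok.mem_vs {c : Chord} (h : c.Ok) {k : ℕ} (hk : k ∈ c.vs) :
    c.lo < k ∧ c.first ≤ k ∧ k ≤ c.last ∧ k < c.hi := by
  obtain ⟨h1, h2, h3, h4⟩ := h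
  simp only [Chord.vs, List.mem_cons] at hk
  rcases hk with rfl | rfl | hk
  · omega
  · omega
  · have := h4 k hk
    omega

theorem six_le_encard {c : ℝ → Plane} {I : Set ℝ} (hc : InjOn c I) {S : Set Plane}
    {u : Fin 6 → ℝ} (hu : Function.Injective u) (hI : ∀ i, u i ∈ I) (hS : ∀ i, c (u i) ∈ S) :
    6 ≤ (S ∩ c '' I).encard := by
  have hinj : Function.Injective fun i => c (u i) := fun i j hij => hu (hc (hI i) (hI j) hij)
  calc (6 : ℕ∞) = (range fun i => c (u i)).encard := by
        rw [← image_univ, hinj.encard_image, encard_univ]; simp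
    _ ≤ (S ∩ c '' I).encard :=
      encard_le_encard (range_subset_iff.2 fun i => ⟨hS i, mem_image_of_mem _ (hI i)⟩)

theorem six_le_encard_of_sorted {c : ℝ → Plane} {I : Set ℝ} (hc : InjOn c I) {S : Set Plane}
    {a b d e f g : ℝ} (h : ∀ u ∈ [a, b, d, e, f, g], u ∈ I ∧ c u ∈ S)
    (hs : [a, b, d, e, f, g].Nodup) : 6 ≤ (S ∩ c '' I).encard :=
  six_le_encard hc (u := [a, b, d, e, f, g].get) (List.nodup_iff_injective_get.1 hs)
    (fun i => (h _ (List.get_mem [a, b, d, e, f, g] i)).1)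
    fun i => (h _ (List.get_mem [a, b, d, e, f, g] i)).2

theorem exists_hit {f : unitCircle → Plane} {c : ℝ → Plane} (hc : Continuous c) {a b : ℝ}
    (ha : c a ∉ closure (insideFun f)) (hb : c b ∈ range f ∨ c b ∈ insideFun f) :
    ∃ u ∈ uIcc a b, c u ∈ range f := by
  rcases hb with hb | hb
  · exact ⟨b, right_mem_uIcc, hb⟩
  · obtain ⟨u, hu, -, h⟩ := exists_mem_range_of_mem_insideFun hc hb fun h => ha (subset_closure h)
    exact ⟨u, uIcc_comm a b ▸ hu, h⟩

theorem exists_hit_strict {f : unitCircle → Plane} (hf : Continuous f)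
    (hinj : Function.Injective f) {c : ℝ → Plane} (hc : Continuous c) {a b : ℝ}
    (ha : c a ∉ closure (insideFun f)) (hb : c b ∈ insideFun f) :
    ∃ u ∈ uIcc a b, u ≠ a ∧ u ≠ b ∧ c u ∈ range f := by
  obtain ⟨u, hu, hub, h⟩ := exists_mem_range_of_mem_insideFun hc hb fun h => ha (subset_closure h)
  refine ⟨u, uIcc_comm a b ▸ hu, ?_, hub, h⟩
  rintro rfl
  exact ha (range_subset_closure_insideFun hf hinj ⟨_, hb⟩ h)

/-- A parametrisation of a track in the plane whose chords leave the closed set `K`. -/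
structure Track.Realizes (τ : Track) (L : ℕ → Plane) (K : Set Plane) (c : ℝ → Plane) : Prop where
  ok : τ.Ok
  continuous : Continuous c
  injOn : InjOn c (Ico 0 (τ.n : ℝ))
  eval : ∀ k < τ.n, c (k : ℝ) = L (τ.code k)
  ends : ∀ k ∈ [τ.left.lo, τ.left.hi, τ.right.lo, τ.right.hi], L (τ.code k) ∉ K

section Count

variable {τ : Track} {L : ℕ → Plane} {K : Set Plane} {c : ℝ → Plane} {f : unitCircle → Plane}

/-- Two middle vertices on the curve force six intersections. -/
theorem Track.Realizes.six_of_mids (h : τ.Realizes L K c) (hK : closure (insideFun f) ⊆ K)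
    (hv : ∀ k ∈ τ.left.vs ++ τ.right.vs, L (τ.code k) ∈ range f ∨ L (τ.code k) ∈ insideFun f)
    {p q : ℕ} (hpq : p ≠ q) (hp : p ∈ τ.mids) (hq : q ∈ τ.mids) (hpf : L p ∈ range f)
    (hqf : L q ∈ range f) : 6 ≤ (range f ∩ c '' Ico 0 (τ.n : ℝ)).encard := by
  obtain ⟨⟨l1, l2, l3, l4⟩, ⟨r1, r2, r3, r4⟩, h3, h4⟩ := h.ok
  have hend : ∀ k < τ.n, k ∈ [τ.left.lo, τ.left.hi, τ.right.lo, τ.right.hi] →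
      c (k : ℝ) ∉ closure (insideFun f) := fun k hk hm hc =>
    h.ends k hm (h.eval k hk ▸ hK hc)
  have hver : ∀ k < τ.n, k ∈ τ.left.vs ++ τ.right.vs →
      c (k : ℝ) ∈ range f ∨ c (k : ℝ) ∈ insideFun f := fun k hk hm => by
    rw [h.eval k hk]; exact hv k hm
  obtain ⟨a1, ha1, ha1'⟩ := exists_hit h.continuous (hend τ.left.lo (by omega) (by simp))
    (hver τ.left.first (by omega) (by simp [Chord.vs]))
  obtain ⟨a2, ha2, ha2'⟩ := exists_hit h.continuous (hend τ.left.hi (by omega) (by simp))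
    (hver τ.left.last (by omega) (by simp [Chord.vs]))
  obtain ⟨b1, hb1, hb1'⟩ := exists_hit h.continuous (hend τ.right.lo (by omega) (by simp))
    (hver τ.right.first (by omega) (by simp [Chord.vs]))
  obtain ⟨b2, hb2, hb2'⟩ := exists_hit h.continuous (hend τ.right.hi (by omega) (by simp))
    (hver τ.right.last (by omega) (by simp [Chord.vs]))
  rw [uIcc_of_le (by exact_mod_cast l1.le)] at ha1
  rw [uIcc_of_ge (by exact_mod_cast l3.le)] at ha2
  rw [uIcc_of_le (by exact_mod_cast r1.le)] at hb1
  rw [uIcc_of_ge (by exact_mod_cast r3.le)] at hb2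
  simp only [Track.mids, List.mem_map, List.mem_append] at hp hq
  obtain ⟨k, hk, rfl⟩ := hp
  obtain ⟨m, hm, rfl⟩ := hq
  have hkm : (k : ℝ) ≠ m := fun hkm => hpq (by rw [Nat.cast_injective hkm])
  have hmid : ∀ k, k ∈ τ.left.mids ∨ k ∈ τ.right.mids → k < τ.n ∧
      ((τ.left.first < k ∧ k < τ.left.last) ∨ (τ.right.first < k ∧ k < τ.right.last)) :=
    fun k hk => by
      rcases hk with hk | hk
      · have := l4 k hk; omega
      · have := r4 k hk; omega
  have hk' := hmid k hk
  have hm' := hmid m hm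
  have hkf : c k ∈ range f := by rw [h.eval k hk'.1]; exact hpf
  have hmf : c m ∈ range f := by rw [h.eval m hm'.1]; exact hqf
  rify at l1 l2 l3 r1 r2 r3 h3 h4 hk' hm'
  have hlo : (0 : ℝ) ≤ τ.left.lo := Nat.cast_nonneg _
  refine six_le_encard_of_sorted (a := a1) (b := a2) (d := b1) (e := b2) (f := k) (g := m)
    h.injOn ?_ ?_
  · simp only [List.mem_cons, List.not_mem_nil, or_false, mem_Ico, mem_Icc] at *
    rintro u (rfl | rfl | rfl | rfl | rfl | rfl)
    · exact ⟨⟨by linarith, by linarith⟩, ha1'⟩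
    · exact ⟨⟨by linarith, by linarith⟩, ha2'⟩
    · exact ⟨⟨by linarith, by linarith⟩, hb1'⟩
    · exact ⟨⟨by linarith, by linarith⟩, hb2'⟩
    · exact ⟨⟨Nat.cast_nonneg _, hk'.1⟩, hkf⟩
    · exact ⟨⟨Nat.cast_nonneg _, hm'.1⟩, hmf⟩
  · simp only [List.nodup_cons, List.mem_cons, List.not_mem_nil, or_false, not_or, mem_Icc,
      List.nodup_nil, not_false_eq_true, and_true, and_assoc] at *
    refine ⟨?_, ?_, ?_, ?_, ?_, ?_, ?_, ?_, ?_, ?_, ?_, ?_, ?_, ?_, hkm⟩ <;>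
      intro heq <;> rcases hk'.2 with h1 | h1 <;> rcases hm'.2 with h2 | h2 <;> linarith

/-- A vertex which is left behind between two inside vertices of a chord forces six
intersections as soon as the other chord has an inside vertex. -/
theorem Track.Realizes.six_of_left_behind (h : τ.Realizes L K c) (hf : Continuous f)
    (hinj : Function.Injective f) (hK : closure (insideFun f) ⊆ K)
    {ab : Chord × Chord} (hab : ab ∈ τ.chords) {k l r x : ℕ} (hk : k ∈ ab.1.vs)
    (hl : l ∈ ab.1.vs) (hr : r ∈ ab.1.vs) (hx : x ∈ ab.2.vs) (hlk : l < k) (hkr : k < r)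
    (hkf : L (τ.code k) ∉ closure (insideFun f)) (hlf : L (τ.code l) ∈ insideFun f)
    (hrf : L (τ.code r) ∈ insideFun f) (hxf : L (τ.code x) ∈ insideFun f) :
    6 ≤ (range f ∩ c '' Ico 0 (τ.n : ℝ)).encard := by
  obtain ⟨hl1, hr1, h3, h4⟩ := h.ok
  have hlen : ab.1.Ok ∧ ab.2.Ok ∧ ab.1.hi < τ.n ∧ ab.2.hi < τ.n ∧
      (ab.1.hi < ab.2.lo ∨ ab.2.hi < ab.1.lo) ∧
      ∀ k ∈ [ab.1.lo, ab.1.hi, ab.2.lo, ab.2.hi], L (τ.code k) ∉ closure (insideFun f) := by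
    have hends := h.ends
    have e1 := hl1.mem_vs (k := τ.left.first) (by simp [Chord.vs])
    have e2 := hr1.mem_vs (k := τ.right.first) (by simp [Chord.vs])
    simp only [Track.chords, List.mem_cons, List.not_mem_nil, or_false] at hab
    rcases hab with rfl | rfl
    · exact ⟨hl1, hr1, by dsimp only; omega, by dsimp only; omega, Or.inl h3,
        fun k hk hc => hends k hk (hK hc)⟩
    · refine ⟨hr1, hl1, by dsimp only; omega, by dsimp only; omega, Or.inr h3,
        fun k hk hc => hends k ?_ (hK hc)⟩
      simp only [List.mem_cons, List.not_mem_nil, or_false] at hk ⊢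
      tauto
  obtain ⟨o1, o2, n1, n2, hdis, hends⟩ := hlen
  have m1 := o1.mem_vs hl
  have m2 := o1.mem_vs hr
  have m3 := o2.mem_vs hx
  have hit : ∀ i < τ.n, ∀ j < τ.n, L (τ.code i) ∉ closure (insideFun f) →
      L (τ.code j) ∈ insideFun f → ∃ u ∈ uIcc (i : ℝ) j, u ≠ i ∧ u ≠ j ∧ c u ∈ range f :=
    fun i hi j hj h1 h2 => exists_hit_strict hf hinj h.continuous
      (by rwa [h.eval i hi]) (by rwa [h.eval j hj])
  obtain ⟨u1, hu1, hu1n, hu1', hu1f⟩ :=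
    hit ab.1.lo (by omega) l (by omega) (hends _ (by simp)) hlf
  obtain ⟨u2, hu2, hu2n, hu2', hu2f⟩ := hit k (by omega) l (by omega) hkf hlf
  obtain ⟨u3, hu3, hu3n, hu3', hu3f⟩ := hit k (by omega) r (by omega) hkf hrf
  obtain ⟨u4, hu4, hu4n, hu4', hu4f⟩ :=
    hit ab.1.hi (by omega) r (by omega) (hends _ (by simp)) hrf
  obtain ⟨u5, hu5, hu5n, hu5', hu5f⟩ :=
    hit ab.2.lo (by omega) x (by omega) (hends _ (by simp)) hxf
  obtain ⟨u6, hu6, hu6n, hu6', hu6f⟩ :=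
    hit ab.2.hi (by omega) x (by omega) (hends _ (by simp)) hxf
  have p1 : (ab.1.lo : ℝ) < l := by exact_mod_cast m1.1
  have p2 : (l : ℝ) < k := by exact_mod_cast hlk
  have p3 : (k : ℝ) < r := by exact_mod_cast hkr
  have p4 : (r : ℝ) < ab.1.hi := by exact_mod_cast m2.2.2.2
  have p5 : (ab.2.lo : ℝ) < x := by exact_mod_cast m3.1
  have p6 : (x : ℝ) < ab.2.hi := by exact_mod_cast m3.2.2.2
  have p7 : (ab.1.hi : ℝ) < τ.n := by exact_mod_cast n1
  have p8 : (ab.2.hi : ℝ) < τ.n := by exact_mod_cast n2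
  have p9 : (ab.1.hi : ℝ) < ab.2.lo ∨ (ab.2.hi : ℝ) < ab.1.lo := by exact_mod_cast hdis
  have p10 : (0 : ℝ) ≤ ab.1.lo := Nat.cast_nonneg _
  have p11 : (0 : ℝ) ≤ ab.2.lo := Nat.cast_nonneg _
  rw [uIcc_of_le p1.le] at hu1
  rw [uIcc_of_ge p2.le] at hu2
  rw [uIcc_of_le p3.le] at hu3
  rw [uIcc_of_ge p4.le] at hu4
  rw [uIcc_of_le p5.le] at hu5
  rw [uIcc_of_ge p6.le] at hu6
  have q1 := lt_of_le_of_ne hu1.2 hu1'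
  have q2 := lt_of_le_of_ne hu2.1 hu2'.symm
  have q2' := lt_of_le_of_ne hu2.2 hu2n
  have q3 := lt_of_le_of_ne hu3.1 hu3n.symm
  have q3' := lt_of_le_of_ne hu3.2 hu3'
  have q4 := lt_of_le_of_ne hu4.1 hu4'.symm
  have q5 := lt_of_le_of_ne hu5.2 hu5'
  have q6 := lt_of_le_of_ne hu6.1 hu6'.symm
  refine six_le_encard_of_sorted (a := u1) (b := u2) (d := u3) (e := u4) (f := u5) (g := u6)
    h.injOn ?_ ?_
  · simp only [List.mem_cons, List.not_mem_nil, or_false, mem_Ico, mem_Icc] at *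
    rintro u (rfl | rfl | rfl | rfl | rfl | rfl)
    · exact ⟨⟨by linarith, by linarith⟩, hu1f⟩
    · exact ⟨⟨by linarith, by linarith⟩, hu2f⟩
    · exact ⟨⟨by linarith, by linarith⟩, hu3f⟩
    · exact ⟨⟨by linarith, by linarith⟩, hu4f⟩
    · exact ⟨⟨by linarith, by linarith⟩, hu5f⟩
    · exact ⟨⟨by linarith, by linarith⟩, hu6f⟩
  · simp only [List.nodup_cons, List.mem_cons, List.not_mem_nil, or_false, not_or, mem_Icc,
      List.nodup_nil, not_false_eq_true, and_true, and_assoc] at *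
    refine ⟨?_, ?_, ?_, ?_, ?_, ?_, ?_, ?_, ?_, ?_, ?_, ?_, ?_, ?_, ?_⟩ <;>
      intro heq <;> rcases p9 with h1 | h1 <;> linarith

end Count

/-- If every vertex is good, then a sweep meets one of the tracks in at least six points. -/
theorem IsSweep.exists_six {γ : JordanCurve} {P : Plane} {F : ℝ → unitCircle → Plane}
    (h : IsSweep γ P F) {T : List Track} {L : ℕ → Plane} {c : Track → ℝ → Plane}
    (hT : ∀ τ ∈ T, τ.Realizes L (closure γ.inside) (c τ)) (hne : verts T ≠ [])
    (hin : ∀ v ∈ verts T, L v ∈ γ.inside ∧ L v ≠ P) (hgood : ∀ v ∈ verts T, Good T v) :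
    ∃ t ∈ Ico (0 : ℝ) 1, ∃ τ ∈ T, 6 ≤ (range (F t) ∩ c τ '' Ico 0 (τ.n : ℝ)).encard := by
  by_contra! hno
  have hmono : ∀ s ∈ Ico (0 : ℝ) 1, ∀ t ∈ Ico (0 : ℝ) 1, s ≤ t →
      closure (insideFun (F t)) ⊆ closure (insideFun (F s)) := fun s hs t ht =>
    h.2.2.2.2.1 s ⟨hs.1, hs.2.le⟩ t ⟨ht.1, ht.2.le⟩
  have h0 : insideFun (F 0) = γ.inside := by rw [h.2.1]; rfl
  have hK : ∀ t ∈ Ico (0 : ℝ) 1, closure (insideFun (F t)) ⊆ closure γ.inside := fun t ht =>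
    h0 ▸ hmono 0 ⟨le_rfl, one_pos⟩ t ht ht.1
  set S : Set ℝ := {t | t ∈ Ico (0 : ℝ) 1 ∧ ∃ v ∈ verts T, L v ∉ closure (insideFun (F t))}
  have hSne : S.Nonempty := by
    obtain ⟨v, hv⟩ := List.exists_mem_of_ne_nil _ hne
    have hev := (h.eventually_notMem_closure (hin v hv).2).filter_mono
      (nhdsWithin_mono 1 (Ioo_subset_Icc_self (a := (0 : ℝ))))
    have : (nhdsWithin (1 : ℝ) (Ioo 0 1)).NeBot := right_nhdsWithin_Ioo_neBot one_pos
    obtain ⟨t, ht, htI⟩ := (hev.and self_mem_nhdsWithin).exists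
    exact ⟨t, ⟨htI.1.le, htI.2⟩, v, hv, ht htI.2⟩
  have hSb : BddBelow S := ⟨0, fun t ht => ht.1.1⟩
  set t₁ := sInf S
  have ht₁ : t₁ ∈ Ico (0 : ℝ) 1 := by
    obtain ⟨t, ht⟩ := hSne
    exact ⟨le_csInf ⟨t, ht⟩ fun s hs => hs.1.1, (csInf_le hSb ht).trans_lt ht.1.2⟩
  have hbelow : ∀ t ∈ Ico (0 : ℝ) 1, t < t₁ → ∀ v ∈ verts T, L v ∈ closure (insideFun (F t)) :=
    fun t ht htt v hv => by
      by_contra hc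
      exact (csInf_le hSb ⟨ht, v, hv, hc⟩).not_gt htt
  have hIoo : ∀ t ∈ Ioo t₁ 1, t ∈ Ico (0 : ℝ) 1 := fun t ht => ⟨ht₁.1.trans ht.1.le, ht.2⟩
  have habove : ∀ t ∈ Ioo t₁ 1, ∃ v ∈ verts T, L v ∉ closure (insideFun (F t)) :=
    fun t ht => by
      obtain ⟨s, ⟨hs, v, hv, hvs⟩, hst⟩ := exists_lt_of_csInf_lt hSne ht.1
      exact ⟨v, hv, fun hc => hvs (hmono s hs t (hIoo t ht) hst.le hc)⟩
  have hor : ∀ v ∈ verts T, L v ∈ range (F t₁) ∨ L v ∈ insideFun (F t₁) := fun v hv => by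
    by_contra! hc
    have hev := h.eventually_mem_insideFun_iff ht₁ hc.1
    rcases ht₁.1.eq_or_lt with h1 | h1
    · rw [← h1, h0] at hc
      exact hc.2 (hin v hv).1
    · have hev' := hev.filter_mono (nhdsWithin_mono t₁
        (show Ioo 0 t₁ ⊆ Icc 0 1 from fun x hx => ⟨hx.1.le, (hx.2.trans ht₁.2).le⟩))
      have : (nhdsWithin t₁ (Ioo 0 t₁)).NeBot := right_nhdsWithin_Ioo_neBot h1
      obtain ⟨t, ht, htI⟩ := (hev'.and self_mem_nhdsWithin).exists
      have ht1 : t < 1 := htI.2.trans ht₁.2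
      have htI' : t ∈ Ico (0 : ℝ) 1 := ⟨htI.1.le, ht1⟩
      exact hc.2 ((ht ht1).2.1 (mem_insideFun_of_mem_closure (h.continuous_apply htI')
        (hbelow t htI' htI.2 v hv) (ht ht1).1))
  have hcode : ∀ τ ∈ T, ∀ k ∈ τ.left.vs ++ τ.right.vs, τ.code k ∈ verts T := fun τ hτ k hk =>
    List.mem_flatMap.2 ⟨τ, hτ, List.mem_map_of_mem hk⟩
  have hexcl : ∀ p q, Excl T p q → L p ∈ range (F t₁) → L q ∉ range (F t₁) := by
    rintro p q ⟨hpq, τ, hτ, hp, hq⟩ hp' hq'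
    exact (hno t₁ ht₁ τ hτ).not_ge ((hT τ hτ).six_of_mids (hK t₁ ht₁)
      (fun k hk => hor _ (hcode τ hτ k hk)) hpq hp hq hp' hq')
  set l := nhdsWithin t₁ (Ioo t₁ 1)
  have hl : l.NeBot := left_nhdsWithin_Ioo_neBot ht₁.2
  have hlI : ∀ᶠ t in l, t ∈ Ioo t₁ 1 := self_mem_nhdsWithin
  obtain ⟨w, hw, hwK⟩ : ∃ w ∈ verts T, ∀ t ∈ Ioo t₁ 1, L w ∉ closure (insideFun (F t)) := by
    by_contra! hc
    have hev : ∀ v ∈ {v | v ∈ verts T}, ∀ᶠ t in l, L v ∈ closure (insideFun (F t)) :=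
      fun v hv => by
        obtain ⟨s, hs, hvs⟩ := hc v hv
        have hlt : ∀ᶠ t in l, t < s :=
          (eventually_lt_nhds hs.1).filter_mono nhdsWithin_le_nhds
        filter_upwards [hlt, hlI] with t hts ht
        exact hmono t (hIoo t ht) s (hIoo s hs) hts.le hvs
    obtain ⟨t, ht, htI⟩ :=
      (((Filter.eventually_all_finite (List.finite_toSet _)).2 hev).and hlI).exists
    obtain ⟨v, hv, hv'⟩ := habove t htI
    exact hv' (ht v hv)
  have hinside : ∀ v ∈ verts T, L v ∉ range (F t₁) → ∀ᶠ t in l, L v ∈ insideFun (F t) :=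
    fun v hv hvr => by
      have hev := (h.eventually_mem_insideFun_iff ht₁ hvr).filter_mono (nhdsWithin_mono t₁
        (show Ioo t₁ 1 ⊆ Icc 0 1 from fun x hx => ⟨ht₁.1.trans hx.1.le, hx.2.le⟩))
      filter_upwards [hev, hlI] with t ht htI
      exact (ht htI.2).2.2 ((hor v hv).resolve_left hvr)
  have hwr : L w ∈ range (F t₁) := by
    by_contra hwr
    obtain ⟨t, ht, htI⟩ := ((hinside w hw hwr).and hlI).exists
    exact hwK t htI (subset_closure ht)
  obtain ⟨τ, hτ, ab, hab, k, hk, rfl, ⟨i, hi, hik, hiw⟩, ⟨r, hr, hkr, hrw⟩, x, hx, y, hy, hxy⟩ :=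
    hgood w hw
  have hvs : ∀ m, m ∈ ab.1.vs ∨ m ∈ ab.2.vs → τ.code m ∈ verts T := fun m hm => by
    refine hcode τ hτ m (List.mem_append.2 ?_)
    simp only [Track.chords, List.mem_cons, List.not_mem_nil, or_false] at hab
    rcases hab with rfl | rfl
    · exact hm
    · exact hm.symm
  have hi' := hinside _ (hvs i (Or.inl hi)) fun hc => hexcl _ _ hiw hc hwr
  have hr' := hinside _ (hvs r (Or.inl hr)) fun hc => hexcl _ _ hrw hc hwr
  obtain ⟨z, hz, hzr⟩ : ∃ z ∈ ab.2.vs, L (τ.code z) ∉ range (F t₁) := by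
    by_cases hxr : L (τ.code x) ∈ range (F t₁)
    · have hyr := hexcl _ _ hxy hxr
      rcases List.mem_cons.1 hy with rfl | hy
      · exact absurd hwr hyr
      · exact ⟨y, hy, hyr⟩
    · exact ⟨x, hx, hxr⟩
  have hz' := hinside _ (hvs z (Or.inr hz)) hzr
  obtain ⟨t, ⟨hit, hrt, hzt⟩, htI⟩ := ((hi'.and (hr'.and hz')).and hlI).exists
  have htI' := hIoo t htI
  exact (hno t htI' τ hτ).not_ge ((hT τ hτ).six_of_left_behind (h.continuous_apply htI')
    (h.injective_apply htI') (hK t htI') hab hk hi hr hz hik hkr (hwK t htI) hit hrt hzt)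

/-- The lattice point with code `c`. -/
def latticePt (c : ℕ) : Plane := !₂[((c % 64 : ℕ) : ℝ), ((c / 64 : ℕ) : ℝ)]

@[simp] theorem latticePt_zero (c : ℕ) : latticePt c 0 = ((c % 64 : ℕ) : ℝ) := rfl

@[simp] theorem latticePt_one (c : ℕ) : latticePt c 1 = ((c / 64 : ℕ) : ℝ) := rfl

theorem plane_ext {p q : Plane} (h0 : p 0 = q 0) (h1 : p 1 = q 1) : p = q := by
  ext i
  fin_cases i
  · exact h0
  · exact h1

theorem latticePt_injective : Function.Injective latticePt := fun a b h => by
  have h0 := congrArg (fun p : Plane => p 0) h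
  have h1 := congrArg (fun p : Plane => p 1) h
  simp only [latticePt_zero, latticePt_one, Nat.cast_inj] at h0 h1
  omega

/-- The codes `a`, `b` belong to horizontally or vertically adjacent lattice points. -/
def UnitStep (a b : ℕ) : Prop := b = a + 1 ∨ a = b + 1 ∨ b = a + 64 ∨ a = b + 64

instance (a b : ℕ) : Decidable (UnitStep a b) := by unfold UnitStep; infer_instance

/-- The code lies in the part of the lattice where steps do not wrap around. -/
def InGrid (c : ℕ) : Prop := 1 ≤ c % 64 ∧ c % 64 ≤ 62 ∧ 1 ≤ c / 64 ∧ c / 64 ≤ 30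

instance (c : ℕ) : Decidable (InGrid c) := by unfold InGrid; infer_instance

/-- The coordinates of a unit step. -/
theorem UnitStep.coords {a b : ℕ} (h : UnitStep a b) (ha : InGrid a) (hb : InGrid b) :
    (((b % 64 : ℕ) : ℤ) = (a % 64 : ℕ) + 1 ∧ ((b / 64 : ℕ) : ℤ) = (a / 64 : ℕ)) ∨
    (((b % 64 : ℕ) : ℤ) = (a % 64 : ℕ) - 1 ∧ ((b / 64 : ℕ) : ℤ) = (a / 64 : ℕ)) ∨
    (((b % 64 : ℕ) : ℤ) = (a % 64 : ℕ) ∧ ((b / 64 : ℕ) : ℤ) = (a / 64 : ℕ) + 1) ∨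
    (((b % 64 : ℕ) : ℤ) = (a % 64 : ℕ) ∧ ((b / 64 : ℕ) : ℤ) = (a / 64 : ℕ) - 1) := by
  unfold UnitStep at h
  unfold InGrid at ha hb
  omega

theorem unit_edges_aux {x y x' y' dx dy dx' dy' : ℤ} {s t : ℝ} (hs : s ∈ Ico (0 : ℝ) 1)
    (ht : t ∈ Ico (0 : ℝ) 1)
    (hd : (dx = 1 ∧ dy = 0) ∨ (dx = -1 ∧ dy = 0) ∨ (dx = 0 ∧ dy = 1) ∨ (dx = 0 ∧ dy = -1))
    (hd' : (dx' = 1 ∧ dy' = 0) ∨ (dx' = -1 ∧ dy' = 0) ∨ (dx' = 0 ∧ dy' = 1) ∨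
      (dx' = 0 ∧ dy' = -1))
    (hx : (x : ℝ) + s * dx = x' + t * dx') (hy : (y : ℝ) + s * dy = y' + t * dy') :
    (s = 0 ∧ t = 0 ∧ x = x' ∧ y = y') ∨
    (s = t ∧ x = x' ∧ y = y' ∧ dx = dx' ∧ dy = dy') ∨
    (x = x' + dx' ∧ y = y' + dy' ∧ x' = x + dx ∧ y' = y + dy) := by
  obtain ⟨hs0, hs1⟩ := hs
  obtain ⟨ht0, ht1⟩ := ht
  obtain ⟨m, hm⟩ : ∃ m : ℤ, x' = x + m := ⟨x' - x, by ring⟩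
  obtain ⟨k, hk⟩ : ∃ k : ℤ, y' = y + k := ⟨y' - y, by ring⟩
  subst hm hk
  push_cast at hx hy
  have key : ∀ z : ℤ, (z : ℝ) < 2 → (-2 : ℝ) < z → z = -1 ∨ z = 0 ∨ z = 1 := fun z h1 h2 => by
    have h1' : z < 2 := by exact_mod_cast h1
    have h2' : -2 < z := by exact_mod_cast h2
    omega
  rcases hd with ⟨rfl, rfl⟩ | ⟨rfl, rfl⟩ | ⟨rfl, rfl⟩ | ⟨rfl, rfl⟩ <;>
  rcases hd' with ⟨rfl, rfl⟩ | ⟨rfl, rfl⟩ | ⟨rfl, rfl⟩ | ⟨rfl, rfl⟩ <;>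
  push_cast at hx hy <;>
  rcases key m (by linarith) (by linarith) with rfl | rfl | rfl <;>
  rcases key k (by linarith) (by linarith) with rfl | rfl | rfl <;>
  push_cast at hx hy <;>
  first
  | (exfalso; linarith)
  | (left; exact ⟨by linarith, by linarith, by omega, by omega⟩)
  | (right; left; exact ⟨by linarith, by omega, by omega, by omega, by omega⟩)
  | (right; right; exact ⟨by omega, by omega, by omega, by omega⟩)

/-- Two half-open unit edges which share a point either start at this common point, or coincide,
or are opposite. -/
theorem unit_edges {a b a' b' : ℕ} (h : UnitStep a b) (h' : UnitStep a' b') (ha : InGrid a)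
    (hb : InGrid b) (ha' : InGrid a') (hb' : InGrid b') {s t : ℝ} (hs : s ∈ Ico (0 : ℝ) 1)
    (ht : t ∈ Ico (0 : ℝ) 1)
    (heq : (1 - s) • latticePt a + s • latticePt b = (1 - t) • latticePt a' + t • latticePt b') :
    (s = 0 ∧ t = 0 ∧ a = a') ∨ (s = t ∧ a = a' ∧ b = b') ∨ (a = b' ∧ b = a') := by
  have hx := congrArg (fun p : Plane => p 0) heq
  have hy := congrArg (fun p : Plane => p 1) heq
  simp only [PiLp.add_apply, PiLp.smul_apply, latticePt_zero, latticePt_one, smul_eq_mul] at hx hy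
  have c1 := h.coords ha hb
  have c2 := h'.coords ha' hb'
  have ea := fun h0 h1 =>
    latticePt_injective (plane_ext (p := latticePt a) (q := latticePt a') h0 h1)
  simp only [latticePt_zero, latticePt_one, Nat.cast_inj] at ea
  have hab : a % 64 = b' % 64 → a / 64 = b' / 64 → a = b' := by omega
  have hba : b % 64 = a' % 64 → b / 64 = a' / 64 → b = a' := by omega
  have hbb : b % 64 = b' % 64 → b / 64 = b' / 64 → b = b' := by omega
  clear h h' ha hb ha' hb' heq
  generalize a % 64 = ax at *
  generalize a / 64 = ay at *
  generalize b % 64 = bx at *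
  generalize b / 64 = bY at *
  generalize a' % 64 = ax' at *
  generalize a' / 64 = ay' at *
  generalize b' % 64 = bx' at *
  generalize b' / 64 = bY' at *
  have := unit_edges_aux (x := ax) (y := ay) (x' := ax') (y' := ay') (dx := (bx : ℤ) - ax)
    (dy := (bY : ℤ) - ay) (dx' := (bx' : ℤ) - ax') (dy' := (bY' : ℤ) - ay') hs ht
    (by clear c2 ea hab hba hbb; omega) (by clear c1 ea hab hba hbb; omega)
    (by push_cast; linarith) (by push_cast; linarith)
  rcases this with ⟨h1, h2, h3, h4⟩ | ⟨h1, h2, h3, h4, h5⟩ | ⟨h1, h2, h3, h4⟩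
  · exact Or.inl ⟨h1, h2, ea (by omega) (by omega)⟩
  · exact Or.inr (Or.inl ⟨h1, ea (by omega) (by omega), hbb (by omega) (by omega)⟩)
  · exact Or.inr (Or.inr ⟨hab (by omega) (by omega), hba (by omega) (by omega)⟩)

/-- The polygonal line through the lattice points with codes `code 0, …, code n`. -/
def polyline (n : ℕ) (code : ℕ → ℕ) (s : ℝ) : Plane :=
  ∑ i ∈ Finset.range (n + 1), max 0 (1 - |s - i|) • latticePt (code i)

theorem continuous_polyline (n : ℕ) (code : ℕ → ℕ) : Continuous (polyline n code) := by
  unfold polyline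
  fun_prop

theorem polyline_add {n k : ℕ} (hk : k < n) (code : ℕ → ℕ) {a : ℝ} (ha : a ∈ Icc (0 : ℝ) 1) :
    polyline n code (k + a) = (1 - a) • latticePt (code k) + a • latticePt (code (k + 1)) := by
  obtain ⟨h0, h1⟩ := ha
  rw [polyline, Finset.sum_eq_add k (k + 1) (by omega)]
  · congr 2
    · rw [add_sub_cancel_left, abs_of_nonneg h0, max_eq_right (by linarith)]
    · push_cast
      rw [add_sub_add_left_eq_sub, abs_of_nonpos (by linarith), max_eq_right (by linarith)]
      ring
  · rintro i - ⟨hik, hik'⟩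
    rw [max_eq_left, zero_smul]
    rcases lt_or_gt_of_ne hik with h | h
    · have : (i : ℝ) + 1 ≤ k := by exact_mod_cast h
      have := le_abs_self ((k : ℝ) + a - i)
      linarith
    · have : (k : ℝ) + 2 ≤ i := by exact_mod_cast (show k + 2 ≤ i by omega)
      have := neg_le_abs ((k : ℝ) + a - i)
      linarith
  · intro h
    exact absurd (Finset.mem_range.2 (by omega)) h
  · intro h
    exact absurd (Finset.mem_range.2 (by omega)) h

theorem polyline_natCast {n k : ℕ} (hk : k ≤ n) (hn : 0 < n) (code : ℕ → ℕ) :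
    polyline n code k = latticePt (code k) := by
  rcases hk.lt_or_eq with h | rfl
  · simpa using polyline_add h code (a := 0) (by simp)
  · obtain ⟨m, rfl⟩ : ∃ m, k = m + 1 := ⟨k - 1, by omega⟩
    simpa using polyline_add (Nat.lt_succ_self m) code (a := 1) (by simp)

theorem exists_nat_add {n : ℕ} {s : ℝ} (hs : s ∈ Ico (0 : ℝ) n) :
    ∃ k < n, ∃ a ∈ Ico (0 : ℝ) 1, s = k + a := by
  refine ⟨⌊s⌋₊, (Nat.floor_lt hs.1).2 hs.2, s - ⌊s⌋₊, ⟨?_, ?_⟩, by ring⟩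
  · linarith [Nat.floor_le hs.1]
  · linarith [Nat.lt_floor_add_one s]

/-- The unit circles in the two models of the plane are homeomorphic. -/
def unitCircleHomeoCircle : unitCircle ≃ₜ Circle where
  toFun s := ⟨toC s, mem_sphere_zero_iff_norm.2 ((toC.norm_map _).trans (by
    simpa [unitCircle] using s.2))⟩
  invFun z := ⟨toC.symm z, by
    rw [unitCircle, mem_sphere_zero_iff_norm, toC.symm.norm_map, Circle.norm_coe]⟩
  left_inv s := Subtype.ext (toC.symm_apply_apply _)
  right_inv z := Circle.ext (toC.apply_symm_apply _)
  continuous_toFun := Continuous.subtype_mk (toC.continuous.comp continuous_subtype_val) _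
  continuous_invFun := by
    have : Continuous ((↑) : Circle → ℂ) := continuous_subtype_val
    exact Continuous.subtype_mk (toC.symm.continuous.comp this) _

/-- A homeomorphism from the unit circle to the standard circle `ℝ / ℤ n`. -/
def circleHomeo {n : ℕ} (hn : 0 < n) : unitCircle ≃ₜ AddCircle (n : ℝ) :=
  unitCircleHomeoCircle.trans (AddCircle.homeomorphCircle (Nat.cast_ne_zero.2 hn.ne')).symm

/-- The point `p` lies in the closed unit square with lower left corner `c`. -/
def InCell (p : Plane) (c : ℤ × ℤ) : Prop :=
  ((c.1 : ℝ) ≤ p 0 ∧ p 0 ≤ c.1 + 1) ∧ ((c.2 : ℝ) ≤ p 1 ∧ p 1 ≤ c.2 + 1)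

/-- The centre of a unit square. -/
def centre (c : ℤ × ℤ) : Plane := !₂[(c.1 : ℝ) + 1 / 2, (c.2 : ℝ) + 1 / 2]

@[simp] theorem centre_zero (c : ℤ × ℤ) : centre c 0 = (c.1 : ℝ) + 1 / 2 := rfl

@[simp] theorem centre_one (c : ℤ × ℤ) : centre c 1 = (c.2 : ℝ) + 1 / 2 := rfl

/-- The interior of the union of a set of unit squares. -/
def cellInterior (X : Set (ℤ × ℤ)) : Set Plane := {p | ∀ c, InCell p c → c ∈ X}

theorem exists_inCell (p : Plane) : ∃ c, InCell p c :=
  ⟨(⌊p 0⌋, ⌊p 1⌋), ⟨Int.floor_le _, (Int.lt_floor_add_one _).le⟩,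
    Int.floor_le _, (Int.lt_floor_add_one _).le⟩

theorem eventually_inCell (p : Plane) : ∀ᶠ q in nhds p, ∀ c, InCell q c → InCell p c := by
  have key : ∀ i : Fin 2, ∀ᶠ q : Plane in nhds p,
      ∀ k : ℤ, (k : ℝ) ≤ q i ∧ q i ≤ k + 1 → (k : ℝ) ≤ p i ∧ p i ≤ k + 1 := fun i => by
    have hc : Continuous fun q : Plane => q i := by fun_prop
    have h1 : ∀ᶠ q : Plane in nhds p, q i < ⌊p i⌋ + 1 :=
      hc.continuousAt.eventually_lt continuousAt_const (Int.lt_floor_add_one _)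
    have h2 : ∀ᶠ q : Plane in nhds p, (⌈p i⌉ : ℝ) - 1 < q i :=
      continuousAt_const.eventually_lt hc.continuousAt (by linarith [Int.ceil_lt_add_one (p i)])
    filter_upwards [h1, h2] with q hq1 hq2 k ⟨hk1, hk2⟩
    constructor
    · have : k < ⌊p i⌋ + 1 := by exact_mod_cast hk1.trans_lt hq1
      exact Int.le_floor.1 (by omega)
    · have : ⌈p i⌉ - 1 < k + 1 := by exact_mod_cast hq2.trans_le hk2
      exact_mod_cast Int.ceil_le.1 (show ⌈p i⌉ ≤ k + 1 by omega)
  filter_upwards [key 0, key 1] with q h0 h1 c hc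
  exact ⟨h0 _ hc.1, h1 _ hc.2⟩

theorem isOpen_cellInterior (X : Set (ℤ × ℤ)) : IsOpen (cellInterior X) :=
  isOpen_iff_eventually.2 fun p hp => by
    filter_upwards [eventually_inCell p] with q hq c hc
    exact hp c (hq c hc)

theorem int_eq_of_open {a b : ℤ} {x : ℝ} (h1 : (a : ℝ) < x) (h2 : x < a + 1) (h3 : (b : ℝ) ≤ x)
    (h4 : x ≤ b + 1) : b = a := by
  have h5 : b < a + 1 := by exact_mod_cast h3.trans_lt h2
  have h6 : a < b + 1 := by exact_mod_cast h1.trans_le h4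
  omega

theorem eq_of_inCell_centre {c d : ℤ × ℤ} (h : InCell (centre c) d) : d = c := by
  obtain ⟨⟨h1, h2⟩, h3, h4⟩ := h
  rw [centre_zero] at h1 h2
  rw [centre_one] at h3 h4
  exact Prod.ext (int_eq_of_open (by linarith) (by linarith) h1 h2)
    (int_eq_of_open (by linarith) (by linarith) h3 h4)

/-- The open segment from a point of a square to its centre is in the interior of the square. -/
theorem eq_of_inCell_of_segment {p q : Plane} {c d : ℤ × ℤ} (hp : InCell p c)
    (hq : q ∈ openSegment ℝ p (centre c)) (hd : InCell q d) : d = c := by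
  obtain ⟨a, b, ha, hb, hab, rfl⟩ := hq
  obtain rfl : a = 1 - b := by linarith
  obtain ⟨⟨h1, h2⟩, h3, h4⟩ := hp
  obtain ⟨⟨h5, h6⟩, h7, h8⟩ := hd
  simp only [PiLp.add_apply, PiLp.smul_apply, smul_eq_mul, centre_zero, centre_one] at *
  refine Prod.ext (int_eq_of_open ?_ ?_ h5 h6) (int_eq_of_open ?_ ?_ h7 h8) <;> nlinarith

/-- Two unit squares share an edge. -/
def CellAdj (c d : ℤ × ℤ) : Prop :=
  (c.2 = d.2 ∧ (d.1 = c.1 + 1 ∨ c.1 = d.1 + 1)) ∨ (c.1 = d.1 ∧ (d.2 = c.2 + 1 ∨ c.2 = d.2 + 1))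

theorem int_near {a b d : ℤ} {t : ℝ} (ht : t ∈ Icc (0 : ℝ) 1) (hab : b = a ∨ b = a + 1 ∨ a = b + 1)
    (h1 : (d : ℝ) ≤ (1 - t) * (a + 1 / 2) + t * (b + 1 / 2))
    (h2 : (1 - t) * (a + 1 / 2) + t * (b + 1 / 2) ≤ d + 1) : d = a ∨ d = b := by
  obtain ⟨h0, h3⟩ := ht
  rcases hab with rfl | rfl | rfl
  · left
    exact int_eq_of_open (x := b + 1 / 2) (by linarith) (by linarith) (by linarith) (by linarith)
  · push_cast at h1 h2
    have : d < a + 2 := by exact_mod_cast (show (d : ℝ) < a + 2 by linarith)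
    have : a < d + 1 := by exact_mod_cast (show (a : ℝ) < d + 1 by linarith)
    omega
  · push_cast at h1 h2
    have : d < b + 2 := by exact_mod_cast (show (d : ℝ) < b + 2 by linarith)
    have : b < d + 1 := by exact_mod_cast (show (b : ℝ) < d + 1 by linarith)
    omega

theorem CellAdj.segment_subset {c d : ℤ × ℤ} (h : CellAdj c d) {X : Set (ℤ × ℤ)} (hc : c ∈ X)
    (hd : d ∈ X) : segment ℝ (centre c) (centre d) ⊆ cellInterior X := by
  rintro q ⟨a, b, ha, hb, hab, rfl⟩ e ⟨⟨h1, h2⟩, h3, h4⟩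
  obtain rfl : a = 1 - b := by linarith
  simp only [PiLp.add_apply, PiLp.smul_apply, smul_eq_mul, centre_zero, centre_one] at *
  have hb1 : b ∈ Icc (0 : ℝ) 1 := ⟨hb, by linarith⟩
  unfold CellAdj at h
  have e1 := int_near hb1 (by omega) h1 h2
  have e2 := int_near hb1 (by omega) h3 h4
  have : e = c ∨ e = d := by
    rw [Prod.ext_iff, Prod.ext_iff]
    omega
  rcases this with rfl | rfl <;> assumption

/-- Adjacency of unit squares of a given set. -/
def AdjIn (X : Set (ℤ × ℤ)) (c d : ℤ × ℤ) : Prop := c ∈ X ∧ d ∈ X ∧ CellAdj c d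

theorem joinedIn_centre {X : Set (ℤ × ℤ)} {c d : ℤ × ℤ} (hc : c ∈ X)
    (h : Relation.ReflTransGen (AdjIn X) c d) :
    JoinedIn (cellInterior X) (centre c) (centre d) := by
  induction h with
  | refl => exact JoinedIn.refl fun e he => eq_of_inCell_centre he ▸ hc
  | tail _ h ih => exact ih.trans (JoinedIn.of_segment_subset (h.2.2.segment_subset h.1 h.2.1))

theorem joinedIn_centre_of_inCell {X : Set (ℤ × ℤ)} {W : Set Plane} (hW : cellInterior X ⊆ W)
    {p : Plane} {c : ℤ × ℤ} (hp : p ∈ W) (hc : c ∈ X) (hpc : InCell p c) :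
    JoinedIn W p (centre c) := by
  refine JoinedIn.of_segment_subset ?_
  rw [← insert_endpoints_openSegment]
  refine insert_subset hp (insert_subset ?_ fun q hq => hW fun e he => ?_)
  · exact hW (joinedIn_centre hc .refl).source_mem
  · rwa [eq_of_inCell_of_segment hpc hq he]

/-- Any two unit squares of the set are joined by a chain of squares sharing edges. -/
def CellConnected (X : Set (ℤ × ℤ)) : Prop :=
  ∀ c ∈ X, ∀ d ∈ X, Relation.ReflTransGen (AdjIn X) c d

theorem CellConnected.pathConn {X : Set (ℤ × ℤ)} {W : Set Plane} (hX : CellConnected X)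
    (hW : cellInterior X ⊆ W) (h : ∀ p ∈ W, ∃ c ∈ X, InCell p c) : PathConn W := fun p hp q hq => by
  obtain ⟨c, hc, hpc⟩ := h p hp
  obtain ⟨d, hd, hqd⟩ := h q hq
  exact (joinedIn_centre_of_inCell hW hp hc hpc).trans
    (((joinedIn_centre hc (hX c hc d hd)).mono hW).trans
      (joinedIn_centre_of_inCell hW hq hd hqd).symm)

theorem pathConn_cellInterior_diff {A B : Set (ℤ × ℤ)} (h : CellConnected (A \ B)) :
    PathConn (cellInterior A \ cellInterior B) := by
  refine h.pathConn (fun p hp => ⟨fun c hc => (hp c hc).1, fun hB => ?_⟩) fun p hp => ?_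
  · obtain ⟨c, hc⟩ := exists_inCell p
    exact (hp c hc).2 (hB c hc)
  · have := hp.2
    simp only [cellInterior, mem_ofPred_eq, not_forall] at this
    obtain ⟨c, hc, hB⟩ := this
    exact ⟨c, ⟨hp.1 c hc, hB⟩, hc⟩

/-- From every square of the set one can walk arbitrarily far away inside the set. -/
def Escapes (X : Set (ℤ × ℤ)) : Prop :=
  ∀ c ∈ X, ∀ N : ℕ, ∃ d, Relation.ReflTransGen (AdjIn X) c d ∧ (N : ℤ) ≤ |d.1|

theorem reflTransGen_ray {X : Set (ℤ × ℤ)} {c : ℤ × ℤ} {u : ℤ} (hu : u = 1 ∨ u = -1)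
    (h : ∀ k : ℕ, (c.1 + k * u, c.2) ∈ X) (k : ℕ) :
    Relation.ReflTransGen (AdjIn X) c (c.1 + k * u, c.2) := by
  induction k with
  | zero => simpa using Relation.ReflTransGen.refl
  | succ k ih =>
    refine ih.tail ⟨h k, h (k + 1), Or.inl ⟨rfl, ?_⟩⟩
    push_cast
    rcases hu with rfl | rfl
    · left; ring
    · right; ring

theorem exists_far_of_ray {X : Set (ℤ × ℤ)} {c : ℤ × ℤ} {u : ℤ} (hu : u = 1 ∨ u = -1)
    (h : ∀ k : ℕ, (c.1 + k * u, c.2) ∈ X) (N : ℕ) :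
    ∃ d, Relation.ReflTransGen (AdjIn X) c d ∧ (N : ℤ) ≤ |d.1| := by
  refine ⟨_, reflTransGen_ray hu h (N + c.1.natAbs), ?_⟩
  push_cast
  rcases hu with rfl | rfl <;> simp only [mul_one, mul_neg] <;> grind

theorem inside_eq_cellInterior {γ : JordanCurve} {A : Set (ℤ × ℤ)}
    (himg : γ.imgᶜ = cellInterior A ∪ cellInterior Aᶜ) (hA : ∀ c ∈ A, |c.1| ≤ 64 ∧ |c.2| ≤ 64)
    (hesc : Escapes Aᶜ) : γ.inside = cellInterior A := by
  have hdisj : Disjoint (cellInterior A) (cellInterior Aᶜ) := disjoint_left.2 fun p h1 h2 => by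
    obtain ⟨c, hc⟩ := exists_inCell p
    exact h2 c hc (h1 c hc)
  have himg' : (range γ.toFun)ᶜ = cellInterior A ∪ cellInterior Aᶜ := himg
  ext p
  constructor
  · rintro ⟨hp, hb⟩
    have hp' : p ∈ cellInterior A ∪ cellInterior Aᶜ := himg' ▸ hp
    refine hp'.resolve_right fun hV => ?_
    obtain ⟨c, hc⟩ := exists_inCell p
    obtain ⟨R, hR⟩ := hb.exists_norm_le
    obtain ⟨N, hN⟩ := exists_nat_gt (R + 1)
    obtain ⟨d, hd, hNd⟩ := hesc c (hV c hc) N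
    have hj : JoinedIn (range γ.toFun)ᶜ p (centre d) := by
      refine JoinedIn.mono ?_ (himg' ▸ subset_union_right)
      exact (joinedIn_centre_of_inCell subset_rfl hV (hV c hc) hc).trans
        (joinedIn_centre (hV c hc) hd)
    have h1 := hR _ ((isPathConnected_pathComponentIn hp).isConnected.isPreconnected
      |>.subset_connectedComponentIn (mem_pathComponentIn_self hp) pathComponentIn_subset hj)
    have h2 : |(d.1 : ℝ) + 1 / 2| ≤ R := (PiLp.norm_apply_le (centre d) 0).trans h1
    have h3 : (N : ℝ) ≤ |(d.1 : ℝ)| := by exact_mod_cast hNd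
    have h4 := abs_sub (d.1 + 1 / 2 : ℝ) (1 / 2)
    rw [add_sub_cancel_right, abs_of_pos (by norm_num : (0 : ℝ) < 1 / 2)] at h4
    linarith
  · intro hp
    have hp' : p ∈ (range γ.toFun)ᶜ := himg' ▸ Or.inl hp
    refine ⟨hp', ?_⟩
    have hsub : connectedComponentIn (range γ.toFun)ᶜ p ⊆ cellInterior A :=
      isPreconnected_connectedComponentIn.subset_left_of_subset_union (isOpen_cellInterior A)
        (isOpen_cellInterior Aᶜ) hdisj (himg' ▸ connectedComponentIn_subset _ _)
        ⟨p, mem_connectedComponentIn hp', hp⟩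
    refine (isBounded_iff_forall_norm_le.2 ⟨200, fun q hq => ?_⟩).subset hsub
    obtain ⟨c, hc⟩ := exists_inCell q
    obtain ⟨h1, h2⟩ := hA c (hq c hc)
    obtain ⟨⟨h3, h4⟩, h5, h6⟩ := hc
    have h1' : |(c.1 : ℝ)| ≤ 64 := by exact_mod_cast h1
    have h2' : |(c.2 : ℝ)| ≤ 64 := by exact_mod_cast h2
    rw [abs_le] at h1' h2'
    rw [EuclideanSpace.norm_eq, Fin.sum_univ_two, Real.norm_eq_abs, Real.norm_eq_abs, sq_abs,
      sq_abs]
    refine Real.sqrt_le_iff.2 ⟨by norm_num, ?_⟩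
    have h7 : (q 0) ^ 2 ≤ 65 ^ 2 := sq_le_sq' (by linarith) (by linarith)
    have h8 : (q 1) ^ 2 ≤ 65 ^ 2 := sq_le_sq' (by linarith) (by linarith)
    linarith

/-- The number whose binary digits mark the members of a list. -/
def maskOf (l : List ℕ) : ℕ := l.foldr (fun k m => 1 <<< k ||| m) 0

theorem testBit_maskOf (l : List ℕ) (k : ℕ) : (maskOf l).testBit k = true ↔ k ∈ l := by
  induction l with
  | nil => simp [maskOf]
  | cons a l ih =>
    have : maskOf (a :: l) = 1 <<< a ||| maskOf l := rfl
    rw [this, Nat.testBit_lor, Bool.or_eq_true, ih, List.mem_cons, Nat.one_shiftLeft,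
      Nat.testBit_two_pow, decide_eq_true_eq, eq_comm]

/-- The unit square with code `k`. -/
def cellOf (k : ℕ) : ℤ × ℤ := ((k % 64 : ℕ), (k / 64 : ℕ))

theorem cellOf_injective : Function.Injective cellOf := fun a b h => by
  simp only [cellOf, Prod.mk.injEq, Nat.cast_inj] at h
  omega

/-- The set of unit squares encoded by the binary digits of a number. -/
def cells (S : ℕ) : Set (ℤ × ℤ) := {c | ∃ k, S.testBit k = true ∧ cellOf k = c}

theorem cellOf_mem_cells {S k : ℕ} : cellOf k ∈ cells S ↔ S.testBit k = true :=
  ⟨fun ⟨_, hl, h⟩ => cellOf_injective h ▸ hl, fun h => ⟨k, h, rfl⟩⟩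

theorem exists_cellOf {c : ℤ × ℤ} (h0 : 0 ≤ c.1) (h1 : c.1 < 64) (h2 : 0 ≤ c.2) :
    cellOf (64 * c.2.toNat + c.1.toNat) = c := by
  refine Prod.ext ?_ ?_
  · change ((_ % 64 : ℕ) : ℤ) = _
    omega
  · change ((_ / 64 : ℕ) : ℤ) = _
    omega

theorem cells_diff (S T : ℕ) : cells S \ cells T = cells (S ^^^ (S &&& T)) := by
  ext c
  constructor
  · rintro ⟨⟨k, hk, rfl⟩, h⟩
    rw [cellOf_mem_cells] at h ⊢
    simp [hk, h]
  · rintro ⟨k, hk, rfl⟩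
    rw [mem_sdiff, cellOf_mem_cells, cellOf_mem_cells]
    simp only [Nat.testBit_xor, Nat.testBit_and] at hk
    revert hk
    cases S.testBit k <;> simp

/-- One round of the flood fill algorithm. -/
def floodStep (M X : ℕ) : ℕ := (X ||| X <<< 1 ||| X >>> 1 ||| X <<< 64 ||| X >>> 64) &&& M

/-- Flood filling from the largest bit, in the given number of rounds, fills the whole mask. -/
def Floods (M N : ℕ) : Prop := (floodStep M)^[N] (1 <<< M.log2 &&& M) = M

instance (M N : ℕ) : Decidable (Floods M N) := by unfold Floods; infer_instance

/-- The rightmost column is not used. -/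
def Narrow (M : ℕ) : Prop := ∀ k, M.testBit k = true → k % 64 < 63

theorem Narrow.adj {M a b : ℕ} (hM : Narrow M) (ha : M.testBit a = true) (hb : M.testBit b = true)
    (h : UnitStep a b) : AdjIn (cells M) (cellOf a) (cellOf b) := by
  refine ⟨cellOf_mem_cells.2 ha, cellOf_mem_cells.2 hb, ?_⟩
  have := hM a ha
  have := hM b hb
  unfold UnitStep at h
  simp only [CellAdj, cellOf]
  omega

theorem exists_of_testBit_floodStep {M X k : ℕ} (h : (floodStep M X).testBit k = true) :
    M.testBit k = true ∧ ∃ l, X.testBit l = true ∧ (l = k ∨ UnitStep l k) := by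
  simp only [floodStep, Nat.testBit_and, Nat.testBit_or, Nat.testBit_shiftLeft,
    Nat.testBit_shiftRight, Bool.and_eq_true, Bool.or_eq_true, decide_eq_true_eq] at h
  obtain ⟨h, hM⟩ := h
  refine ⟨hM, ?_⟩
  unfold UnitStep
  rcases h with (((h | ⟨h1, h⟩) | h) | ⟨h1, h⟩) | h
  · exact ⟨_, h, Or.inl rfl⟩
  all_goals exact ⟨_, h, Or.inr (by omega)⟩

theorem AdjIn.symm {X : Set (ℤ × ℤ)} {c d : ℤ × ℤ} (h : AdjIn X c d) : AdjIn X d c := by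
  refine ⟨h.2.1, h.1, ?_⟩
  have := h.2.2
  unfold CellAdj at this ⊢
  omega

theorem cellConnected_of_floods {M N : ℕ} (hM : Narrow M) (h : Floods M N) :
    CellConnected (cells M) := by
  have key : ∀ N k, ((floodStep M)^[N] (1 <<< M.log2 &&& M)).testBit k = true →
      M.testBit k = true ∧ Relation.ReflTransGen (AdjIn (cells M)) (cellOf M.log2) (cellOf k) := by
    intro N
    induction N with
    | zero =>
      intro k hk
      simp only [Function.iterate_zero, id, Nat.testBit_and, Nat.one_shiftLeft,
        Nat.testBit_two_pow, Bool.and_eq_true, decide_eq_true_eq] at hk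
      obtain ⟨rfl, hk⟩ := hk
      exact ⟨hk, .refl⟩
    | succ N ih =>
      intro k hk
      rw [Function.iterate_succ_apply'] at hk
      obtain ⟨hMk, l, hl, hlk⟩ := exists_of_testBit_floodStep hk
      obtain ⟨hMl, hl⟩ := ih l hl
      rcases hlk with rfl | hlk
      · exact ⟨hMk, hl⟩
      · exact ⟨hMk, hl.tail (hM.adj hMl hMk hlk)⟩
  rintro _ ⟨k, hk, rfl⟩ _ ⟨l, hl, rfl⟩
  rw [← h] at hk hl
  refine Relation.ReflTransGen.trans ?_ (key N l hl).2
  have : Std.Symm (AdjIn (cells M)) := ⟨fun _ _ => AdjIn.symm⟩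
  exact Relation.ReflTransGen.stdSymm.symm _ _ (key N k hk).2

/-- The squares in the columns `0, …, 62` and the rows `0, …, 31`. -/
def boxMask : ℕ := (List.range 32).foldr (fun j m => (2 ^ 63 - 1) <<< (64 * j) ||| m) 0

theorem testBit_boxMask (k : ℕ) : boxMask.testBit k = true ↔ k % 64 < 63 ∧ k < 2048 := by
  have : ∀ n, ((List.range n).foldr (fun j m => (2 ^ 63 - 1) <<< (64 * j) ||| m) 0).testBit k
      = true ↔ k % 64 < 63 ∧ k < 64 * n := by
    have h : ∀ l : List ℕ, (l.foldr (fun j m => (2 ^ 63 - 1) <<< (64 * j) ||| m) 0).testBit k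
        = true ↔ k % 64 < 63 ∧ k / 64 ∈ l := by
      intro l
      induction l with
      | nil => simp
      | cons a l ih =>
        rw [List.foldr_cons, Nat.testBit_or, Bool.or_eq_true, ih, Nat.testBit_shiftLeft,
          Nat.testBit_two_pow_sub_one, Bool.and_eq_true, decide_eq_true_eq, decide_eq_true_eq,
          List.mem_cons, and_or_left, show (k ≥ 64 * a ∧ k - 64 * a < 63) ↔
          (k % 64 < 63 ∧ k / 64 = a) by omega]
    intro n
    rw [h, List.mem_range]
    omega
  exact this 32

/-- The squares of `S` avoid the outermost rows and columns of the box. -/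
def InBox (S : ℕ) : Prop :=
  S >>> 1984 = 0 ∧ ∀ j < 31, (S >>> (64 * j)) % 2 ^ 64 % 2 = 0 ∧
    (S >>> (64 * j)) % 2 ^ 64 < 2 ^ 62 ∧ (j = 0 → (S >>> (64 * j)) % 2 ^ 64 = 0)

instance (S : ℕ) : Decidable (InBox S) := by unfold InBox; infer_instance

theorem InBox.bound {S k : ℕ} (h : InBox S) (hk : S.testBit k = true) :
    1 ≤ k % 64 ∧ k % 64 ≤ 61 ∧ 1 ≤ k / 64 ∧ k / 64 ≤ 30 := by
  obtain ⟨h1, h2⟩ := h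
  have hk31 : k < 1984 := by
    by_contra! hk'
    obtain ⟨l, rfl⟩ := Nat.exists_eq_add_of_le hk'
    rw [← Nat.testBit_shiftRight, h1] at hk
    simp at hk
  obtain ⟨h3, h4, h5⟩ := h2 (k / 64) (by omega)
  have hr : ((S >>> (64 * (k / 64))) % 2 ^ 64).testBit (k % 64) = true := by
    rw [Nat.testBit_mod_two_pow, Nat.testBit_shiftRight, Nat.div_add_mod, hk]
    simp [Nat.mod_lt]
  generalize (S >>> (64 * (k / 64))) % 2 ^ 64 = r at *
  have h6 : k % 64 < 62 := (Nat.pow_lt_pow_iff_right (by norm_num : 1 < 2)).1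
    ((Nat.ge_two_pow_of_testBit hr).trans_lt h4)
  have h7 : k % 64 ≠ 0 := fun h0 => by
    rw [h0, Nat.testBit_zero, h3] at hr
    simp at hr
  have h8 : k / 64 ≠ 0 := fun h0 => by
    rw [h5 h0] at hr
    simp at hr
  omega

theorem InBox.narrow {S : ℕ} (h : InBox S) : Narrow S := fun k hk => by
  have := h.bound hk
  omega

theorem Narrow.diff {S : ℕ} (h : Narrow S) (T : ℕ) : Narrow (S ^^^ (S &&& T)) := fun k hk => by
  refine h k ?_
  simp only [Nat.testBit_xor, Nat.testBit_and] at hk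
  revert hk
  cases S.testBit k <;> simp

theorem narrow_boxMask : Narrow boxMask := fun k hk => ((testBit_boxMask k).1 hk).1

theorem InBox.escapes {S N : ℕ} (h : InBox S) (hf : Floods (boxMask ^^^ (boxMask &&& S)) N) :
    Escapes (cells S)ᶜ := by
  have hconn := cellConnected_of_floods (narrow_boxMask.diff S) hf
  rw [← cells_diff] at hconn
  have hmem : ∀ c : ℤ × ℤ, c.1 ≤ 0 ∨ 62 ≤ c.1 ∨ c.2 ≤ 0 ∨ 31 ≤ c.2 → c ∈ (cells S)ᶜ := by
    rintro _ hc ⟨k, hk, rfl⟩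
    have := h.bound hk
    simp only [cellOf] at hc
    omega
  intro c hc K
  by_cases hr : 62 < c.1
  · exact exists_far_of_ray (Or.inl rfl) (fun k => hmem _ (by dsimp only; omega)) K
  by_cases hl : c.1 ≤ 0 ∨ c.2 ≤ 0 ∨ 31 ≤ c.2
  · exact exists_far_of_ray (Or.inr rfl) (fun k => hmem _ (by dsimp only; omega)) K
  · have hbox : ∀ d : ℤ × ℤ, 0 ≤ d.1 → d.1 ≤ 62 → 0 ≤ d.2 → d.2 ≤ 31 → d ∈ cells boxMask :=
      fun d h0 h1 h2 h3 => by
        rw [← exists_cellOf h0 (by omega) h2, cellOf_mem_cells, testBit_boxMask]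
        omega
    have h1 := hconn c ⟨hbox c (by omega) (by omega) (by omega) (by omega), hc⟩ (0, 0)
      ⟨hbox _ (by simp) (by simp) (by simp) (by simp), hmem _ (Or.inl le_rfl)⟩
    obtain ⟨d, hd, hK⟩ := exists_far_of_ray (X := (cells S)ᶜ) (c := (0, 0)) (Or.inr rfl)
      (fun k => hmem _ (by dsimp only; omega)) K
    have hsub : AdjIn (cells boxMask \ cells S) ≤ AdjIn (cells S)ᶜ :=
      fun a b hab => ⟨hab.1.2, hab.2.1.2, hab.2.2⟩
    exact ⟨d, .trans (Relation.ReflTransGen.mono hsub _ _ h1) hd, hK⟩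

/-- `p` lies on the vertical unit edge above the lattice point with code `a`. -/
def OnVEdge (a : ℕ) (p : Plane) : Prop :=
  p 0 = (a % 64 : ℕ) ∧ ((a / 64 : ℕ) : ℝ) ≤ p 1 ∧ p 1 ≤ (a / 64 : ℕ) + 1

/-- `p` lies on the horizontal unit edge to the right of the lattice point with code `a`. -/
def OnHEdge (a : ℕ) (p : Plane) : Prop :=
  p 1 = (a / 64 : ℕ) ∧ ((a % 64 : ℕ) : ℝ) ≤ p 0 ∧ p 0 ≤ (a % 64 : ℕ) + 1

theorem InGrid.cellOf_sub_one {a : ℕ} (h : InGrid a) :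
    cellOf (a - 1) = (((a % 64 : ℕ) : ℤ) - 1, ((a / 64 : ℕ) : ℤ)) := by
  unfold InGrid at h
  refine Prod.ext ?_ ?_ <;> simp only [cellOf] <;> omega

theorem InGrid.cellOf_sub {a : ℕ} (h : InGrid a) :
    cellOf (a - 64) = (((a % 64 : ℕ) : ℤ), ((a / 64 : ℕ) : ℤ) - 1) := by
  unfold InGrid at h
  refine Prod.ext ?_ ?_ <;> simp only [cellOf] <;> omega

theorem InGrid.cellOf_sub_sub {a : ℕ} (h : InGrid a) :
    cellOf (a - 65) = (((a % 64 : ℕ) : ℤ) - 1, ((a / 64 : ℕ) : ℤ) - 1) := by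
  unfold InGrid at h
  refine Prod.ext ?_ ?_ <;> simp only [cellOf] <;> omega

theorem OnVEdge.inCell {a : ℕ} {p : Plane} (h : OnVEdge a p) (ha : InGrid a) :
    InCell p (cellOf a) ∧ InCell p (cellOf (a - 1)) := by
  obtain ⟨h1, h2, h3⟩ := h
  rw [ha.cellOf_sub_one]
  simp only [InCell, cellOf, h1, Int.cast_sub, Int.cast_natCast, Int.cast_one]
  refine ⟨⟨⟨?_, ?_⟩, ?_, ?_⟩, ⟨?_, ?_⟩, ?_, ?_⟩ <;> linarith

theorem OnHEdge.inCell {a : ℕ} {p : Plane} (h : OnHEdge a p) (ha : InGrid a) :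
    InCell p (cellOf a) ∧ InCell p (cellOf (a - 64)) := by
  obtain ⟨h1, h2, h3⟩ := h
  rw [ha.cellOf_sub]
  simp only [InCell, cellOf, h1, Int.cast_sub, Int.cast_natCast, Int.cast_one]
  refine ⟨⟨⟨?_, ?_⟩, ?_, ?_⟩, ⟨?_, ?_⟩, ?_, ?_⟩ <;> linarith

theorem UnitStep.onEdge {a b : ℕ} (h : UnitStep a b) (ha : InGrid a) (hb : InGrid b) {t : ℝ}
    (ht : t ∈ Icc (0 : ℝ) 1) :
    (a % 64 = b % 64 ∧ OnVEdge (min a b) ((1 - t) • latticePt a + t • latticePt b)) ∨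
    (a / 64 = b / 64 ∧ OnHEdge (min a b) ((1 - t) • latticePt a + t • latticePt b)) := by
  obtain ⟨h0, h1⟩ := ht
  simp only [OnVEdge, OnHEdge, PiLp.add_apply, PiLp.smul_apply, latticePt_zero, latticePt_one,
    smul_eq_mul]
  unfold InGrid at ha hb
  rcases h with rfl | rfl | rfl | rfl
  · rw [show (a + 1) % 64 = a % 64 + 1 by omega, show (a + 1) / 64 = a / 64 by omega,
      min_eq_left (by omega), Nat.cast_succ]
    exact Or.inr ⟨rfl, by linarith, by linarith, by linarith⟩
  · rw [show (b + 1) % 64 = b % 64 + 1 by omega, show (b + 1) / 64 = b / 64 by omega,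
      min_eq_right (by omega), Nat.cast_succ]
    exact Or.inr ⟨rfl, by linarith, by linarith, by linarith⟩
  · rw [show (a + 64) % 64 = a % 64 by omega, show (a + 64) / 64 = a / 64 + 1 by omega,
      min_eq_left (by omega), Nat.cast_succ]
    exact Or.inl ⟨rfl, by linarith, by linarith, by linarith⟩
  · rw [show (b + 64) % 64 = b % 64 by omega, show (b + 64) / 64 = b / 64 + 1 by omega,
      min_eq_right (by omega), Nat.cast_succ]
    exact Or.inl ⟨rfl, by linarith, by linarith, by linarith⟩

theorem UnitStep.exists_of_onVEdge {a b : ℕ} (h : UnitStep a b) (hab : a % 64 = b % 64)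
    {p : Plane} (hp : OnVEdge (min a b) p) :
    ∃ t ∈ Icc (0 : ℝ) 1, p = (1 - t) • latticePt a + t • latticePt b := by
  obtain ⟨h1, h2, h3⟩ := hp
  unfold UnitStep at h
  rcases (show b = a + 64 ∨ a = b + 64 by omega) with rfl | rfl
  · rw [min_eq_left (by omega)] at *
    refine ⟨p 1 - (a / 64 : ℕ), ⟨by linarith, by linarith⟩, plane_ext ?_ ?_⟩ <;>
      simp only [PiLp.add_apply, PiLp.smul_apply, latticePt_zero, latticePt_one, smul_eq_mul, h1,
        ← hab, show (a + 64) / 64 = a / 64 + 1 by omega, Nat.cast_succ] <;> ring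
  · rw [min_eq_right (by omega)] at *
    refine ⟨1 - (p 1 - (b / 64 : ℕ)), ⟨by linarith, by linarith⟩, plane_ext ?_ ?_⟩ <;>
      simp only [PiLp.add_apply, PiLp.smul_apply, latticePt_zero, latticePt_one, smul_eq_mul, h1,
        hab, show (b + 64) / 64 = b / 64 + 1 by omega, Nat.cast_succ] <;> ring

theorem UnitStep.exists_of_onHEdge {a b : ℕ} (h : UnitStep a b) (hab : a / 64 = b / 64)
    {p : Plane} (hp : OnHEdge (min a b) p) :
    ∃ t ∈ Icc (0 : ℝ) 1, p = (1 - t) • latticePt a + t • latticePt b := by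
  obtain ⟨h1, h2, h3⟩ := hp
  unfold UnitStep at h
  rcases (show b = a + 1 ∨ a = b + 1 by omega) with rfl | rfl
  · rw [min_eq_left (by omega)] at *
    refine ⟨p 0 - (a % 64 : ℕ), ⟨by linarith, by linarith⟩, plane_ext ?_ ?_⟩ <;>
      simp only [PiLp.add_apply, PiLp.smul_apply, latticePt_zero, latticePt_one, smul_eq_mul, h1,
        ← hab, show (a + 1) % 64 = a % 64 + 1 by omega, Nat.cast_succ] <;> ring
  · rw [min_eq_right (by omega)] at *
    refine ⟨1 - (p 0 - (b % 64 : ℕ)), ⟨by linarith, by linarith⟩, plane_ext ?_ ?_⟩ <;>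
      simp only [PiLp.add_apply, PiLp.smul_apply, latticePt_zero, latticePt_one, smul_eq_mul, h1,
        hab, show (b + 1) % 64 = b % 64 + 1 by omega, Nat.cast_succ] <;> ring

/-- A closed lattice polygon of the given length: the digits of `word` in base `4096` are the
codes of its lattice points, and the digits of `area` in base `2` mark the unit squares it
surrounds. -/
structure GridCurve where
  length : ℕ
  word : ℕ
  area : ℕ

theorem int_le_add_one {a b : ℤ} (h : (a : ℝ) ≤ b + 1) : a ≤ b + 1 := by
  exact_mod_cast h

namespace GridCurve

variable (C : GridCurve)

/-- The code of the lattice point number `k` on the curve. -/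
def code (k : ℕ) : ℕ := C.word >>> (12 * (k % C.length)) % 4096

/-- The lower end points of the vertical edges. -/
def vEdges : List ℕ :=
  ((List.range C.length).filter fun k => C.code k % 64 = C.code (k + 1) % 64).map
    fun k => min (C.code k) (C.code (k + 1))

/-- The left end points of the horizontal edges. -/
def hEdges : List ℕ :=
  ((List.range C.length).filter fun k => C.code k / 64 = C.code (k + 1) / 64).map
    fun k => min (C.code k) (C.code (k + 1))

/-- The curve is a simple closed lattice polygon with the given area. -/
def Ok : Prop :=
  (3 ≤ C.length ∧ InBox C.area ∧
    ∀ k < C.length, InGrid (C.code k) ∧ UnitStep (C.code k) (C.code (k + 1)) ∧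
      ∀ l < k, C.code l ≠ C.code k) ∧
  C.area ^^^ C.area <<< 1 = maskOf C.vEdges ∧ C.area ^^^ C.area <<< 64 = maskOf C.hEdges ∧
  Floods (boxMask ^^^ (boxMask &&& C.area)) 120

instance : Decidable C.Ok := by unfold Ok; infer_instance

/-- The parametrisation of the curve by `[0, C.length)`. -/
def param : ℝ → Plane := polyline C.length C.code

/-- The points on the curve. -/
def points : Set Plane := C.param '' Ico 0 (C.length : ℝ)

theorem code_add_length (k : ℕ) : C.code (k + C.length) = C.code k := by
  simp [code]

variable {C}

theorem mem_vEdges {a : ℕ} : a ∈ C.vEdges ↔ ∃ k < C.length,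
    C.code k % 64 = C.code (k + 1) % 64 ∧ min (C.code k) (C.code (k + 1)) = a := by
  simp [vEdges, and_assoc]

theorem mem_hEdges {a : ℕ} : a ∈ C.hEdges ↔ ∃ k < C.length,
    C.code k / 64 = C.code (k + 1) / 64 ∧ min (C.code k) (C.code (k + 1)) = a := by
  simp [hEdges, and_assoc]

theorem exists_of_mem_points {p : Plane} (hp : p ∈ C.points) :
    ∃ k < C.length, ∃ t ∈ Ico (0 : ℝ) 1, C.param (k + t) = p ∧
      p = (1 - t) • latticePt (C.code k) + t • latticePt (C.code (k + 1)) := by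
  obtain ⟨s, hs, rfl⟩ := hp
  obtain ⟨k, hk, t, ht, rfl⟩ := exists_nat_add hs
  exact ⟨k, hk, t, ht, rfl, polyline_add hk _ (Ico_subset_Icc_self ht)⟩

namespace Ok

theorem pos (h : C.Ok) : 0 < C.length := by have := h.1.1; omega

theorem inGrid (h : C.Ok) (k : ℕ) : InGrid (C.code k) := by
  have := (h.1.2.2 (k % C.length) (Nat.mod_lt _ h.pos)).1
  rwa [code, Nat.mod_mod] at this

theorem unitStep (h : C.Ok) {k : ℕ} (hk : k < C.length) : UnitStep (C.code k) (C.code (k + 1)) :=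
  (h.1.2.2 k hk).2.1

theorem code_injOn (h : C.Ok) {k l : ℕ} (hk : k < C.length) (hl : l < C.length)
    (hkl : C.code k = C.code l) : k = l := by
  rcases lt_trichotomy k l with hlt | rfl | hlt
  · exact absurd hkl ((h.1.2.2 l hl).2.2 k hlt)
  · rfl
  · exact absurd hkl.symm ((h.1.2.2 k hk).2.2 l hlt)

theorem testBit_ne_of_vEdge (h : C.Ok) {a : ℕ} (ha : 1 ≤ a) :
    C.area.testBit a ≠ C.area.testBit (a - 1) ↔ a ∈ C.vEdges := by
  rw [← testBit_maskOf, ← h.2.1]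
  simp [ha]

theorem testBit_ne_of_hEdge (h : C.Ok) {a : ℕ} (ha : 64 ≤ a) :
    C.area.testBit a ≠ C.area.testBit (a - 64) ↔ a ∈ C.hEdges := by
  rw [← testBit_maskOf, ← h.2.2.1]
  simp [ha]

theorem mem_points (h : C.Ok) {k : ℕ} (hk : k < C.length) {t : ℝ} (ht : t ∈ Icc (0 : ℝ) 1) :
    (1 - t) • latticePt (C.code k) + t • latticePt (C.code (k + 1)) ∈ C.points := by
  rw [← polyline_add hk _ ht]
  have hk' : (k : ℝ) + 1 ≤ C.length := by exact_mod_cast hk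
  have hk0 : (0 : ℝ) ≤ k := Nat.cast_nonneg k
  rcases (show (k : ℝ) + t ≤ C.length by linarith [ht.2]).lt_or_eq with hlt | heq
  · exact ⟨_, ⟨by linarith [ht.1], hlt⟩, rfl⟩
  · refine ⟨0, ⟨le_rfl, by exact_mod_cast h.pos⟩, ?_⟩
    have h0 := polyline_natCast (Nat.zero_le C.length) h.pos C.code
    rw [Nat.cast_zero] at h0
    rw [heq, polyline_natCast le_rfl h.pos, param, h0, ← C.code_add_length 0, Nat.zero_add]

theorem latticePt_mem_points (h : C.Ok) (k : ℕ) : latticePt (C.code k) ∈ C.points := by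
  have := h.mem_points (Nat.mod_lt k h.pos) (t := 0) (by simp)
  simpa [code] using this

theorem param_injOn (h : C.Ok) : InjOn C.param (Ico 0 (C.length : ℝ)) := by
  intro s hs s' hs' heq
  obtain ⟨k, hk, t, ht, rfl⟩ := exists_nat_add hs
  obtain ⟨k', hk', t', ht', rfl⟩ := exists_nat_add hs'
  rw [param, polyline_add hk _ (Ico_subset_Icc_self ht),
    polyline_add hk' _ (Ico_subset_Icc_self ht')] at heq
  rcases unit_edges (h.unitStep hk) (h.unitStep hk') (h.inGrid _) (h.inGrid _) (h.inGrid _)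
    (h.inGrid _) ht ht' heq with ⟨rfl, rfl, h1⟩ | ⟨rfl, h1, -⟩ | ⟨h1, h2⟩
  · rw [h.code_injOn hk hk' h1]
  · rw [h.code_injOn hk hk' h1]
  · exfalso
    have h3 := h.1.1
    rw [code, code, ← Nat.mod_mod (k' + 1), ← code, ← code] at h1
    rw [code, code, ← Nat.mod_mod (k + 1), ← code, ← code] at h2
    have h1 := h.code_injOn hk (Nat.mod_lt _ h.pos) h1
    have h2 := h.code_injOn (Nat.mod_lt _ h.pos) hk' h2
    have e : ∀ m < C.length, (m + 1) % C.length = m + 1 ∨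
        m + 1 = C.length ∧ (m + 1) % C.length = 0 :=
      fun m hm => by
        rcases (show m + 1 ≤ C.length from hm).lt_or_eq with hlt | heq
        · exact Or.inl (Nat.mod_eq_of_lt hlt)
        · exact Or.inr ⟨heq, by rw [heq, Nat.mod_self]⟩
    have := e k hk
    have := e k' hk'
    omega

theorem mem_points_of_row (h : C.Ok) {p : Plane} {c e : ℤ × ℤ} (hpc : InCell p c)
    (hpe : InCell p e) (hce : c.2 = e.2) (hc : c ∈ cells C.area) (he : e ∉ cells C.area) :
    p ∈ C.points := by
  obtain ⟨k, hk, rfl⟩ := hc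
  have hb := h.1.2.1.bound hk
  have hne : (cellOf k).1 ≠ e.1 := fun h1 => he (Prod.ext h1 hce ▸ cellOf_mem_cells.2 hk)
  obtain ⟨⟨h1, h2⟩, h3, h4⟩ := hpc
  obtain ⟨⟨h5, h6⟩, -⟩ := hpe
  have h7 : (cellOf k).1 ≤ e.1 + 1 := int_le_add_one (h1.trans h6)
  have h8 : e.1 ≤ (cellOf k).1 + 1 := int_le_add_one (h5.trans h2)
  have key : ∀ a, 1 ≤ a → C.area.testBit a ≠ C.area.testBit (a - 1) → OnVEdge a p →
      p ∈ C.points := by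
    intro a ha hne hp
    obtain ⟨m, hm, hv, rfl⟩ := mem_vEdges.1 ((h.testBit_ne_of_vEdge ha).1 hne)
    obtain ⟨t, ht, rfl⟩ := (h.unitStep hm).exists_of_onVEdge hv hp
    exact h.mem_points hm ht
  rcases (show e.1 = (cellOf k).1 + 1 ∨ (cellOf k).1 = e.1 + 1 by omega) with h9 | h9
  · have hek : e = cellOf (k + 1) := by
      refine Prod.ext ?_ ?_ <;> simp only [cellOf] at * <;> omega
    rw [hek, cellOf_mem_cells] at he
    refine key (k + 1) (by omega) (by rw [Nat.add_sub_cancel, hk]; exact he) ⟨?_, ?_, ?_⟩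
    · rw [h9] at h5
      simp only [cellOf, Int.cast_add, Int.cast_natCast, Int.cast_one] at h2 h5
      rw [show (k + 1) % 64 = k % 64 + 1 by omega, Nat.cast_succ]
      linarith
    · rw [show (k + 1) / 64 = k / 64 by omega]
      exact_mod_cast h3
    · rw [show (k + 1) / 64 = k / 64 by omega]
      exact_mod_cast h4
  · have hek : e = cellOf (k - 1) := by
      refine Prod.ext ?_ ?_ <;> simp only [cellOf] at * <;> omega
    rw [hek, cellOf_mem_cells] at he
    refine key k (by omega) (by rw [hk]; exact fun h => he h.symm) ⟨?_, ?_, ?_⟩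
    · rw [h9] at h1
      have : (e.1 : ℝ) + 1 = ((cellOf k).1 : ℤ) := by rw [h9, Int.cast_add, Int.cast_one]
      simp only [cellOf, Int.cast_natCast] at this
      rw [Int.cast_add, Int.cast_one] at h1
      linarith
    · exact_mod_cast h3
    · exact_mod_cast h4

theorem mem_points_of_column (h : C.Ok) {p : Plane} {c e : ℤ × ℤ} (hpc : InCell p c)
    (hpe : InCell p e) (hce : c.1 = e.1) (hc : c ∈ cells C.area) (he : e ∉ cells C.area) :
    p ∈ C.points := by
  obtain ⟨k, hk, rfl⟩ := hc
  have hb := h.1.2.1.bound hk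
  have hne : (cellOf k).2 ≠ e.2 := fun h1 => he (Prod.ext hce h1 ▸ cellOf_mem_cells.2 hk)
  obtain ⟨⟨h3, h4⟩, h1, h2⟩ := hpc
  obtain ⟨-, h5, h6⟩ := hpe
  have h7 : (cellOf k).2 ≤ e.2 + 1 := int_le_add_one (h1.trans h6)
  have h8 : e.2 ≤ (cellOf k).2 + 1 := int_le_add_one (h5.trans h2)
  have key : ∀ a, 64 ≤ a → C.area.testBit a ≠ C.area.testBit (a - 64) → OnHEdge a p →
      p ∈ C.points := by
    intro a ha hne hp
    obtain ⟨m, hm, hv, rfl⟩ := mem_hEdges.1 ((h.testBit_ne_of_hEdge ha).1 hne)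
    obtain ⟨t, ht, rfl⟩ := (h.unitStep hm).exists_of_onHEdge hv hp
    exact h.mem_points hm ht
  rcases (show e.2 = (cellOf k).2 + 1 ∨ (cellOf k).2 = e.2 + 1 by omega) with h9 | h9
  · have hek : e = cellOf (k + 64) := by
      refine Prod.ext ?_ ?_ <;> simp only [cellOf] at * <;> omega
    rw [hek, cellOf_mem_cells] at he
    refine key (k + 64) (by omega) (by rw [Nat.add_sub_cancel, hk]; exact he) ⟨?_, ?_, ?_⟩
    · rw [h9] at h5
      simp only [cellOf, Int.cast_add, Int.cast_natCast, Int.cast_one] at h2 h5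
      rw [show (k + 64) / 64 = k / 64 + 1 by omega, Nat.cast_succ]
      linarith
    · rw [show (k + 64) % 64 = k % 64 by omega]
      exact_mod_cast h3
    · rw [show (k + 64) % 64 = k % 64 by omega]
      exact_mod_cast h4
  · have hek : e = cellOf (k - 64) := by
      refine Prod.ext ?_ ?_ <;> simp only [cellOf] at * <;> omega
    rw [hek, cellOf_mem_cells] at he
    refine key k (by omega) (by rw [hk]; exact fun h => he h.symm) ⟨?_, ?_, ?_⟩
    · rw [h9] at h1
      have : (e.2 : ℝ) + 1 = ((cellOf k).2 : ℤ) := by rw [h9, Int.cast_add, Int.cast_one]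
      simp only [cellOf, Int.cast_natCast] at this
      rw [Int.cast_add, Int.cast_one] at h1
      linarith
    · exact_mod_cast h3
    · exact_mod_cast h4

theorem points_eq (h : C.Ok) :
    C.points = (cellInterior (cells C.area) ∪ cellInterior (cells C.area)ᶜ)ᶜ := by
  have mixed : ∀ {p a b}, InCell p (cellOf a) → InCell p (cellOf b) →
      C.area.testBit a ≠ C.area.testBit b →
      p ∉ cellInterior (cells C.area) ∪ cellInterior (cells C.area)ᶜ := by
    intro p a b ha hb hne hp
    rcases hp with hp | hp
    · exact hne ((cellOf_mem_cells.1 (hp _ ha)).trans (cellOf_mem_cells.1 (hp _ hb)).symm)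
    · have h1 := hp _ ha
      have h2 := hp _ hb
      rw [mem_compl_iff, cellOf_mem_cells, Bool.not_eq_true] at h1 h2
      exact hne (h1.trans h2.symm)
  apply subset_antisymm
  · intro p hp
    obtain ⟨k, hk, t, ht, -, rfl⟩ := exists_of_mem_points hp
    have hgr : InGrid (min (C.code k) (C.code (k + 1))) := by
      rcases min_choice (C.code k) (C.code (k + 1)) with h | h <;> rw [h] <;> apply inGrid <;>
        assumption
    have hgr' := hgr
    unfold InGrid at hgr'
    rcases (h.unitStep hk).onEdge (h.inGrid _) (h.inGrid _) (Ico_subset_Icc_self ht) with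
      ⟨hv, hp⟩ | ⟨hv, hp⟩
    · exact mixed (hp.inCell hgr).1 (hp.inCell hgr).2
        ((h.testBit_ne_of_vEdge (by omega)).2 (mem_vEdges.2 ⟨k, hk, hv, rfl⟩))
    · exact mixed (hp.inCell hgr).1 (hp.inCell hgr).2
        ((h.testBit_ne_of_hEdge (by omega)).2 (mem_hEdges.2 ⟨k, hk, hv, rfl⟩))
  · intro p hp
    simp only [mem_compl_iff, mem_union, not_or, cellInterior, mem_ofPred_eq, not_forall,
      not_not] at hp
    obtain ⟨⟨d, hpd, hd⟩, c, hpc, hc⟩ := hp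
    have hpe : InCell p (d.1, c.2) := ⟨hpd.1, hpc.2⟩
    by_cases he : (d.1, c.2) ∈ cells C.area
    · exact h.mem_points_of_column hpe hpd rfl he hd
    · exact h.mem_points_of_row hpc hpe rfl hc he

end Ok

end GridCurve

theorem AddCircle.exists_coe_eq {n : ℝ} [Fact (0 < n)] (x : AddCircle n) :
    ∃ s ∈ Ico 0 n, (s : AddCircle n) = x := by
  have := AddCircle.coe_image_Ico_eq n 0
  rw [zero_add] at this
  exact (this ▸ mem_univ x : x ∈ ((↑) : ℝ → AddCircle n) '' Ico 0 n)

namespace GridCurve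

variable {C D : GridCurve}

theorem Ok.exists_jordanCurve (h : C.Ok) : ∃ γ : JordanCurve, γ.img = C.points := by
  have hpos : (0 : ℝ) < C.length := by exact_mod_cast h.pos
  have : Fact ((0 : ℝ) < C.length) := ⟨hpos⟩
  set f := AddCircle.liftIco (C.length : ℝ) 0 C.param with hf
  have hfs : ∀ s ∈ Ico (0 : ℝ) C.length, f s = C.param s := fun s hs =>
    AddCircle.liftIco_zero_coe_apply hs
  have hend : C.param 0 = C.param C.length := by
    have h0 := polyline_natCast (Nat.zero_le C.length) h.pos C.code
    rw [Nat.cast_zero] at h0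
    rw [param, h0, polyline_natCast le_rfl h.pos, ← C.code_add_length 0, Nat.zero_add]
  have hcont : Continuous f :=
    AddCircle.liftIco_zero_continuous hend (continuous_polyline _ _).continuousOn
  have hinj : Function.Injective f := fun x y hxy => by
    obtain ⟨s, hs, rfl⟩ := AddCircle.exists_coe_eq x
    obtain ⟨t, ht, rfl⟩ := AddCircle.exists_coe_eq y
    rw [hfs s hs, hfs t ht] at hxy
    rw [h.param_injOn hs ht hxy]
  refine ⟨⟨f ∘ circleHomeo h.pos, hcont.comp (circleHomeo h.pos).continuous,
    hinj.comp (circleHomeo h.pos).injective⟩, ?_⟩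
  change range (f ∘ circleHomeo h.pos) = _
  rw [(circleHomeo h.pos).surjective.range_comp]
  apply subset_antisymm
  · rintro _ ⟨x, rfl⟩
    obtain ⟨s, hs, rfl⟩ := AddCircle.exists_coe_eq x
    exact ⟨s, hs, (hfs s hs).symm⟩
  · rintro _ ⟨s, hs, rfl⟩
    exact ⟨s, hfs s hs⟩

/-- A Jordan curve which runs along a lattice polygon. -/
def Ok.curve (h : C.Ok) : JordanCurve := h.exists_jordanCurve.choose

theorem Ok.img_curve (h : C.Ok) : h.curve.img = C.points := h.exists_jordanCurve.choose_spec

theorem Ok.inside_curve (h : C.Ok) : h.curve.inside = cellInterior (cells C.area) := by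
  refine inside_eq_cellInterior ?_ ?_ (h.1.2.1.escapes h.2.2.2)
  · rw [h.img_curve, h.points_eq, compl_compl]
  · rintro _ ⟨k, hk, rfl⟩
    have := h.1.2.1.bound hk
    simp only [cellOf]
    rw [abs_le, abs_le]
    omega

theorem Ok.notMem_closure_inside (h : C.Ok) {p : Plane} (hp : p ∈ cellInterior (cells C.area)ᶜ) :
    p ∉ closure h.curve.inside := by
  rw [h.inside_curve, mem_closure_iff_nhds]
  intro hcl
  obtain ⟨q, hq1, hq2⟩ := hcl _ ((isOpen_cellInterior _).mem_nhds hp)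
  obtain ⟨c, hc⟩ := exists_inCell q
  exact hq1 c hc (hq2 c hc)

/-- The mask of the codes of the lattice points of a curve. -/
def mask (C : GridCurve) : ℕ := maskOf ((List.range C.length).map C.code)

theorem testBit_mask {a : ℕ} : C.mask.testBit a = true ↔ ∃ k < C.length, C.code k = a := by
  simp [mask, testBit_maskOf]

/-- At the given lattice point the first region has a horizontal boundary, and the second one a
vertical boundary. -/
def Crosses (S T a : ℕ) : Prop :=
  (S.testBit a = S.testBit (a - 1) ∧ S.testBit (a - 64) = S.testBit (a - 65) ∧
    S.testBit a ≠ S.testBit (a - 64)) ∧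
  (T.testBit a = T.testBit (a - 64) ∧ T.testBit (a - 1) = T.testBit (a - 65) ∧
    T.testBit a ≠ T.testBit (a - 1))

instance (S T a : ℕ) : Decidable (Crosses S T a) := by unfold Crosses; infer_instance

/-- The indices of the common lattice points of two curves. -/
def common (C D : GridCurve) : List ℕ :=
  (List.range C.length).filter fun k => D.mask.testBit (C.code k)

/-- The curves meet only in crossings, of which there are at most four, and they are
non-piercing. -/
def Compatible (C D : GridCurve) : Prop :=
  maskOf C.vEdges &&& maskOf D.vEdges = 0 ∧ maskOf C.hEdges &&& maskOf D.hEdges = 0 ∧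
  (common C D).length ≤ 4 ∧
  (∀ k ∈ common C D, Crosses C.area D.area (C.code k) ∨ Crosses D.area C.area (C.code k)) ∧
  Floods (C.area ^^^ (C.area &&& D.area)) 80

instance : Decidable (Compatible C D) := by unfold Compatible; infer_instance

theorem Compatible.exists_of_mem (h : Compatible C D) (hC : C.Ok) (hD : D.Ok) {p : Plane}
    (hpC : p ∈ C.points) (hpD : p ∈ D.points) :
    ∃ k ∈ common C D, p = latticePt (C.code k) := by
  obtain ⟨k, hk, s, hs, -, hp⟩ := exists_of_mem_points hpC
  obtain ⟨l, hl, t, ht, -, hp'⟩ := exists_of_mem_points hpD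
  have hedge : ∀ {v w a : ℕ}, v &&& w = 0 → ¬(v.testBit a = true ∧ w.testBit a = true) := by
    intro v w a hvw ⟨h1, h2⟩
    have := Nat.testBit_and v w a
    rw [hvw, h1, h2] at this
    simp at this
  have hno : C.code k % 64 = C.code (k + 1) % 64 ∨ C.code k / 64 = C.code (k + 1) / 64 := by
    have h1 := hC.unitStep hk
    have h2 := hC.inGrid k
    have h3 := hC.inGrid (k + 1)
    unfold UnitStep at h1
    unfold InGrid at h2 h3
    omega
  have hsame : ¬((C.code k = D.code l ∧ C.code (k + 1) = D.code (l + 1)) ∨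
      (C.code k = D.code (l + 1) ∧ C.code (k + 1) = D.code l)) := by
    intro heq
    have hmin : min (D.code l) (D.code (l + 1)) = min (C.code k) (C.code (k + 1)) := by omega
    rcases hno with hv | hv
    · refine hedge h.1 (a := min (C.code k) (C.code (k + 1))) ?_
      rw [testBit_maskOf, testBit_maskOf, mem_vEdges, mem_vEdges]
      exact ⟨⟨k, hk, hv, rfl⟩, l, hl, by omega, hmin⟩
    · refine hedge h.2.1 (a := min (C.code k) (C.code (k + 1))) ?_
      rw [testBit_maskOf, testBit_maskOf, mem_hEdges, mem_hEdges]
      exact ⟨⟨k, hk, hv, rfl⟩, l, hl, by omega, hmin⟩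
  rcases unit_edges (hC.unitStep hk) (hD.unitStep hl) (hC.inGrid _) (hC.inGrid _) (hD.inGrid _)
    (hD.inGrid _) hs ht (hp.symm.trans hp') with ⟨rfl, rfl, h1⟩ | ⟨-, h1, h2⟩ | ⟨h1, h2⟩
  · refine ⟨k, ?_, by simpa using hp⟩
    rw [common, List.mem_filter, List.mem_range, testBit_mask]
    exact ⟨hk, l, hl, h1.symm⟩
  · exact absurd (Or.inl ⟨h1, h2⟩) hsame
  · exact absurd (Or.inr ⟨h1, h2⟩) hsame

theorem Compatible.encard_le (h : Compatible C D) (hC : C.Ok) (hD : D.Ok) :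
    (C.points ∩ D.points).encard ≤ 4 := by
  have hsub : C.points ∩ D.points ⊆
      (((common C D).map fun k => latticePt (C.code k)).toFinset : Set Plane) := by
    rintro p ⟨hpC, hpD⟩
    obtain ⟨k, hk, rfl⟩ := h.exists_of_mem hC hD hpC hpD
    simp only [List.coe_toFinset, List.mem_map, mem_ofPred_eq]
    exact ⟨k, hk, rfl⟩
  refine (encard_le_encard hsub).trans ?_
  rw [encard_coe_eq_coe_finsetCard]
  have := (List.toFinset_card_le ((common C D).map fun k => latticePt (C.code k)))
  rw [List.length_map] at this
  exact_mod_cast this.trans h.2.2.1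

theorem Compatible.pathConn (h : Compatible C D) (hC : C.Ok) (hD : D.Ok) :
    PathConn (hC.curve.inside \ hD.curve.inside) := by
  rw [hC.inside_curve, hD.inside_curve]
  refine pathConn_cellInterior_diff ?_
  rw [cells_diff]
  exact cellConnected_of_floods (hC.1.2.1.narrow.diff _) h.2.2.2.2

/-- The point at signed horizontal distance `u` and vertical distance `v` from a lattice point. -/
def nearPt (a : ℕ) (u v : ℝ) : Plane := !₂[((a % 64 : ℕ) : ℝ) + u, ((a / 64 : ℕ) : ℝ) + v]

theorem int_eq_of_near {b : ℤ} {m : ℕ} {u : ℝ} (hu : |u| < 1) (h1 : (b : ℝ) ≤ m + u)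
    (h2 : (m : ℝ) + u ≤ b + 1) : (b = m ∧ 0 ≤ u) ∨ (b = m - 1 ∧ u ≤ 0) := by
  rw [abs_lt] at hu
  have h3 : b < m + 1 := by exact_mod_cast (show (b : ℝ) < m + 1 by linarith)
  have h4 : (m : ℤ) < b + 2 := by exact_mod_cast (show (m : ℝ) < b + 2 by linarith)
  rcases (show b = m ∨ b = m - 1 by omega) with rfl | rfl
  · refine Or.inl ⟨rfl, ?_⟩
    push_cast at h1
    linarith
  · refine Or.inr ⟨rfl, ?_⟩
    push_cast at h2
    linarith

theorem _root_.InGrid.cells_nearPt {a : ℕ} (ha : InGrid a) {u v : ℝ} (hu : |u| < 1) (hv : |v| < 1)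
    {c : ℤ × ℤ} (hc : InCell (nearPt a u v) c) :
    (c = cellOf a ∧ 0 ≤ u ∧ 0 ≤ v) ∨ (c = cellOf (a - 1) ∧ u ≤ 0 ∧ 0 ≤ v) ∨
    (c = cellOf (a - 64) ∧ 0 ≤ u ∧ v ≤ 0) ∨ (c = cellOf (a - 65) ∧ u ≤ 0 ∧ v ≤ 0) := by
  rw [ha.cellOf_sub_one, ha.cellOf_sub, ha.cellOf_sub_sub]
  simp only [cellOf, Prod.ext_iff]
  have h1 := int_eq_of_near hu hc.1.1 hc.1.2
  have h2 := int_eq_of_near hv hc.2.1 hc.2.2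
  tauto

theorem _root_.InGrid.nearPt_mem {a : ℕ} (ha : InGrid a) {u v : ℝ} (hu : |u| < 1) (hv : |v| < 1)
    {X : Set (ℤ × ℤ)} (h1 : 0 ≤ u → 0 ≤ v → cellOf a ∈ X) (h2 : u ≤ 0 → 0 ≤ v → cellOf (a - 1) ∈ X)
    (h3 : 0 ≤ u → v ≤ 0 → cellOf (a - 64) ∈ X) (h4 : u ≤ 0 → v ≤ 0 → cellOf (a - 65) ∈ X) :
    nearPt a u v ∈ cellInterior X := by
  intro c hc
  rcases ha.cells_nearPt hu hv hc with ⟨rfl, h, h'⟩ | ⟨rfl, h, h'⟩ | ⟨rfl, h, h'⟩ | ⟨rfl, h, h'⟩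
  · exact h1 h h'
  · exact h2 h h'
  · exact h3 h h'
  · exact h4 h h'

end GridCurve

theorem _root_.InGrid.inCell_nearPt {a : ℕ} (ha : InGrid a) {u v : ℝ} (hu : |u| ≤ 1)
    (hv : |v| ≤ 1) :
    (0 ≤ u → 0 ≤ v → InCell (GridCurve.nearPt a u v) (cellOf a)) ∧
    (u ≤ 0 → 0 ≤ v → InCell (GridCurve.nearPt a u v) (cellOf (a - 1))) ∧
    (0 ≤ u → v ≤ 0 → InCell (GridCurve.nearPt a u v) (cellOf (a - 64))) ∧
    (u ≤ 0 → v ≤ 0 → InCell (GridCurve.nearPt a u v) (cellOf (a - 65))) := by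
  rw [ha.cellOf_sub_one, ha.cellOf_sub, ha.cellOf_sub_sub]
  rw [abs_le] at hu hv
  simp only [InCell, cellOf, Int.cast_sub, Int.cast_natCast, Int.cast_one]
  change (0 ≤ u → 0 ≤ v → (_ ≤ ((a % 64 : ℕ) : ℝ) + u ∧ ((a % 64 : ℕ) : ℝ) + u ≤ _) ∧
    (_ ≤ ((a / 64 : ℕ) : ℝ) + v ∧ ((a / 64 : ℕ) : ℝ) + v ≤ _)) ∧
    (u ≤ 0 → 0 ≤ v → (_ ≤ ((a % 64 : ℕ) : ℝ) + u ∧ ((a % 64 : ℕ) : ℝ) + u ≤ _) ∧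
    (_ ≤ ((a / 64 : ℕ) : ℝ) + v ∧ ((a / 64 : ℕ) : ℝ) + v ≤ _)) ∧
    (0 ≤ u → v ≤ 0 → (_ ≤ ((a % 64 : ℕ) : ℝ) + u ∧ ((a % 64 : ℕ) : ℝ) + u ≤ _) ∧
    (_ ≤ ((a / 64 : ℕ) : ℝ) + v ∧ ((a / 64 : ℕ) : ℝ) + v ≤ _)) ∧
    (u ≤ 0 → v ≤ 0 → (_ ≤ ((a % 64 : ℕ) : ℝ) + u ∧ ((a % 64 : ℕ) : ℝ) + u ≤ _) ∧
    (_ ≤ ((a / 64 : ℕ) : ℝ) + v ∧ ((a / 64 : ℕ) : ℝ) + v ≤ _))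
  refine ⟨fun h1 h2 => ⟨⟨?_, ?_⟩, ?_, ?_⟩, fun h1 h2 => ⟨⟨?_, ?_⟩, ?_, ?_⟩,
    fun h1 h2 => ⟨⟨?_, ?_⟩, ?_, ?_⟩, fun h1 h2 => ⟨⟨?_, ?_⟩, ?_, ?_⟩⟩ <;> linarith

namespace GridCurve

variable {C D : GridCurve}

theorem Ok.mem_points_of_inCell (h : C.Ok) {p : Plane} {a b : ℕ} (ha : InCell p (cellOf a))
    (hb : InCell p (cellOf b)) (hne : C.area.testBit a ≠ C.area.testBit b) : p ∈ C.points := by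
  rw [h.points_eq]
  rintro (hp | hp)
  · exact hne ((cellOf_mem_cells.1 (hp _ ha)).trans (cellOf_mem_cells.1 (hp _ hb)).symm)
  · have h1 := hp _ ha
    have h2 := hp _ hb
    rw [mem_compl_iff, cellOf_mem_cells, Bool.not_eq_true] at h1 h2
    exact hne (h1.trans h2.symm)

theorem nearPt_zero (a : ℕ) : nearPt a 0 0 = latticePt a :=
  plane_ext (add_zero _) (add_zero _)

theorem exists_nearPt_mem {a : ℕ} {U : Set Plane} (hU : U ∈ nhds (latticePt a)) :
    ∃ ε : ℝ, 0 < ε ∧ ε < 1 ∧ nearPt a ε 0 ∈ U ∧ nearPt a (-ε) 0 ∈ U ∧ nearPt a 0 ε ∈ U ∧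
      nearPt a 0 (-ε) ∈ U := by
  have hev : ∀ f : ℝ → Plane, Continuous f → f 0 = latticePt a →
      ∀ᶠ ε in nhdsWithin (0 : ℝ) (Ioi 0), f ε ∈ U := fun f hf h0 =>
    nhdsWithin_le_nhds (hf.continuousAt (h0 ▸ hU))
  have h1 := hev (fun ε => nearPt a ε 0) (by unfold nearPt; fun_prop) (nearPt_zero a)
  have h2 := hev (fun ε => nearPt a (-ε) 0) (by unfold nearPt; fun_prop) (by simp [nearPt_zero])
  have h3 := hev (fun ε => nearPt a 0 ε) (by unfold nearPt; fun_prop) (nearPt_zero a)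
  have h4 := hev (fun ε => nearPt a 0 (-ε)) (by unfold nearPt; fun_prop) (by simp [nearPt_zero])
  have h5 : ∀ᶠ ε in nhdsWithin (0 : ℝ) (Ioi 0), ε ∈ Ioo (0 : ℝ) 1 := Ioo_mem_nhdsGT one_pos
  obtain ⟨ε, h1, h2, h3, h4, h5, h6⟩ := (h1.and (h2.and (h3.and (h4.and h5)))).exists
  exact ⟨ε, h5, h6, h1, h2, h3, h4⟩

theorem mem_cellInterior_or {S : ℕ} {U Q : Set Plane} {p q : Plane} {b b' : Bool} (hb : b ≠ b')
    (hp : p ∈ U ∧ p ∈ Q) (hq : q ∈ U ∧ q ∈ Q)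
    (hpb : ∀ X : Set (ℤ × ℤ), (∀ k, S.testBit k = b → cellOf k ∈ X) → p ∈ cellInterior X)
    (hqb : ∀ X : Set (ℤ × ℤ), (∀ k, S.testBit k = b' → cellOf k ∈ X) → q ∈ cellInterior X) :
    (∃ r ∈ U, r ∈ Q ∧ r ∈ cellInterior (cells S)) ∧
    ∃ r ∈ U, r ∈ Q ∧ r ∈ cellInterior (cells S)ᶜ := by
  have ht : ∀ k, S.testBit k = true → cellOf k ∈ cells S := fun k => cellOf_mem_cells.2
  have hf : ∀ k, S.testBit k = false → cellOf k ∈ (cells S)ᶜ := fun k hk => by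
    rw [mem_compl_iff, cellOf_mem_cells, hk]
    exact Bool.false_ne_true
  cases b
  · obtain rfl : b' = true := by simpa using hb.symm
    exact ⟨⟨q, hq.1, hq.2, hqb _ ht⟩, p, hp.1, hp.2, hpb _ hf⟩
  · obtain rfl : b' = false := by simpa using hb.symm
    exact ⟨⟨p, hp.1, hp.2, hpb _ ht⟩, q, hq.1, hq.2, hqb _ hf⟩

theorem isCrossing_of_crosses (hC : C.Ok) (hD : D.Ok) {a : ℕ} (ha : InGrid a)
    (h : Crosses C.area D.area a) : IsCrossing hC.curve hD.curve (latticePt a) := by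
  intro U hU
  obtain ⟨ε, h0, h1, hr, hl, hu, hd⟩ := exists_nearPt_mem hU
  obtain ⟨⟨c1, c2, c3⟩, d1, d2, d3⟩ := h
  have hε : |ε| < 1 := by rwa [abs_of_pos h0]
  have hε' : |-ε| < 1 := by rwa [abs_neg]
  have hz : |(0 : ℝ)| < 1 := by simp
  have h0' : ¬0 ≤ -ε := by linarith
  have h0'' : ¬ε ≤ 0 := by linarith
  have hnp : -ε ≤ 0 := by linarith
  obtain ⟨r1, r2, r3, r4⟩ := ha.inCell_nearPt hε.le hz.le
  obtain ⟨l1, l2, l3, l4⟩ := ha.inCell_nearPt hε'.le hz.le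
  obtain ⟨u1, u2, u3, u4⟩ := ha.inCell_nearPt hz.le hε.le
  obtain ⟨d1', d2', d3', d4'⟩ := ha.inCell_nearPt hz.le hε'.le
  have key := mem_cellInterior_or (S := D.area) (U := U) (Q := hC.curve.img) d3
    (p := nearPt a ε 0) (q := nearPt a (-ε) 0)
    ⟨hr, hC.img_curve ▸ hC.mem_points_of_inCell (r1 h0.le le_rfl) (r3 h0.le le_rfl) c3⟩
    ⟨hl, hC.img_curve ▸ hC.mem_points_of_inCell (l2 hnp le_rfl) (l4 hnp le_rfl)
      (by rwa [← c1, ← c2])⟩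
    (fun X hX => ha.nearPt_mem hε hz (fun _ _ => hX _ rfl) (fun h _ => absurd h h0'')
      (fun _ _ => hX _ d1.symm) (fun h _ => absurd h h0''))
    (fun X hX => ha.nearPt_mem hε' hz (fun h _ => absurd h h0') (fun _ _ => hX _ rfl)
      (fun h _ => absurd h h0') (fun _ _ => hX _ d2.symm))
  have key' := mem_cellInterior_or (S := C.area) (U := U) (Q := hD.curve.img) c3
    (p := nearPt a 0 ε) (q := nearPt a 0 (-ε))
    ⟨hu, hD.img_curve ▸ hD.mem_points_of_inCell (u1 le_rfl h0.le) (u2 le_rfl h0.le) d3⟩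
    ⟨hd, hD.img_curve ▸ hD.mem_points_of_inCell (d3' le_rfl hnp) (d4' le_rfl hnp)
      (by rwa [← d1, ← d2])⟩
    (fun X hX => ha.nearPt_mem hz hε (fun _ _ => hX _ rfl) (fun _ _ => hX _ c1.symm)
      (fun _ h => absurd h h0'') (fun _ h => absurd h h0''))
    (fun X hX => ha.nearPt_mem hz hε' (fun _ h => absurd h h0') (fun _ h => absurd h h0')
      (fun _ _ => hX _ rfl) (fun _ _ => hX _ c2.symm))
  rw [hC.inside_curve, hD.inside_curve]
  refine ⟨key.1, ?_, key'.1, ?_⟩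
  · obtain ⟨q, h1, h2, h3⟩ := key.2
    exact ⟨q, h1, h2, hD.inside_curve ▸ hD.notMem_closure_inside h3⟩
  · obtain ⟨q, h1, h2, h3⟩ := key'.2
    exact ⟨q, h1, h2, hC.inside_curve ▸ hC.notMem_closure_inside h3⟩

theorem Compatible.isCrossing (h : Compatible C D) (hC : C.Ok) (hD : D.Ok) {p : Plane}
    (hp : p ∈ hC.curve.img ∩ hD.curve.img) : IsCrossing hC.curve hD.curve p := by
  rw [hC.img_curve, hD.img_curve] at hp
  obtain ⟨k, hk, rfl⟩ := h.exists_of_mem hC hD hp.1 hp.2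
  rcases h.2.2.2.1 k hk with hx | hx
  · exact isCrossing_of_crosses hC hD (hC.inGrid k) hx
  · intro U hU
    obtain ⟨h1, h2, h3, h4⟩ := isCrossing_of_crosses hD hC (hC.inGrid k) hx U hU
    exact ⟨h3, h4, h1, h2⟩

theorem Ok.latticePt_mem_inside (h : C.Ok) {a : ℕ} (ha : InGrid a)
    (hb : ∀ d ∈ [0, 1, 64, 65], C.area.testBit (a - d) = true) : latticePt a ∈ h.curve.inside := by
  have hz : |(0 : ℝ)| < 1 := by simp
  simp only [List.forall_mem_cons, tsub_zero] at hb
  obtain ⟨h0, h1, h2, h3, -⟩ := hb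
  rw [h.inside_curve, ← nearPt_zero]
  exact ha.nearPt_mem hz hz (fun _ _ => cellOf_mem_cells.2 h0) (fun _ _ => cellOf_mem_cells.2 h1)
    (fun _ _ => cellOf_mem_cells.2 h2) (fun _ _ => cellOf_mem_cells.2 h3)

theorem Ok.latticePt_notMem_closure_inside (h : C.Ok) {a : ℕ} (ha : InGrid a)
    (hb : ∀ d ∈ [0, 1, 64, 65], C.area.testBit (a - d) = false) :
    latticePt a ∉ closure h.curve.inside := by
  have hz : |(0 : ℝ)| < 1 := by simp
  have hf : ∀ {k}, C.area.testBit k = false → cellOf k ∈ (cells C.area)ᶜ := fun {k} hk => by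
    rw [mem_compl_iff, cellOf_mem_cells, hk]
    exact Bool.false_ne_true
  simp only [List.forall_mem_cons, tsub_zero] at hb
  obtain ⟨h0, h1, h2, h3, -⟩ := hb
  rw [← nearPt_zero]
  exact h.notMem_closure_inside (ha.nearPt_mem hz hz (fun _ _ => hf h0) (fun _ _ => hf h1)
    (fun _ _ => hf h2) (fun _ _ => hf h3))

theorem Ok.centre_mem_inside (h : C.Ok) {c : ℤ × ℤ} (hc : c ∈ cells C.area) :
    centre c ∈ h.curve.inside := by
  rw [h.inside_curve]
  exact fun d hd => eq_of_inCell_centre hd ▸ hc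

theorem Ok.centre_notMem_img (h : C.Ok) (c : ℤ × ℤ) : centre c ∉ h.curve.img := by
  rw [h.img_curve, h.points_eq, notMem_compl_iff]
  by_cases hc : c ∈ cells C.area
  · exact Or.inl fun d hd => eq_of_inCell_centre hd ▸ hc
  · exact Or.inr fun d hd => eq_of_inCell_centre hd ▸ hc

theorem latticePt_ne_centre (a : ℕ) (c : ℤ × ℤ) : latticePt a ≠ centre c := by
  intro h
  have h0 := congrArg (fun p : Plane => 2 * p 0) h
  simp only [latticePt_zero, centre_zero] at h0
  generalize a % 64 = m at h0
  have : (2 * m : ℤ) = 2 * c.1 + 1 := by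
    have : (2 : ℝ) * m = 2 * c.1 + 1 := by linarith
    exact_mod_cast this
  omega

end GridCurve

namespace GridCurve

variable {C D : GridCurve}

/-- A lattice curve with two chords, as a track. -/
def track (C : GridCurve) (ab : Chord × Chord) : Track := ⟨C.length, C.code, ab.1, ab.2⟩

/-- The end points of the chords of a track lie outside the area `S`. -/
def EndsOutside (S : ℕ) (τ : Track) : Prop :=
  ∀ k ∈ [τ.left.lo, τ.left.hi, τ.right.lo, τ.right.hi], ∀ d ∈ [0, 1, 64, 65],
    S.testBit (τ.code k - d) = false

instance (S : ℕ) (τ : Track) : Decidable (EndsOutside S τ) := by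
  unfold EndsOutside; infer_instance

theorem Ok.realizes (hC : C.Ok) (hD : D.Ok) {ab : Chord × Chord} (hab : (D.track ab).Ok)
    (hends : EndsOutside C.area (D.track ab)) :
    (D.track ab).Realizes latticePt (closure hC.curve.inside) D.param where
  ok := hab
  continuous := continuous_polyline _ _
  injOn := hD.param_injOn
  eval _ hk := polyline_natCast hk.le hD.pos _
  ends k hk := hC.latticePt_notMem_closure_inside (hD.inGrid k) (hends k hk)

theorem Compatible.testBit_mask_and (h : Compatible C D) (hC : C.Ok) (hD : D.Ok) {p : Plane}
    (hp : p ∈ hC.curve.img ∩ hD.curve.img) :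
    ∃ a, (C.mask &&& D.mask).testBit a = true ∧ p = latticePt a := by
  rw [hC.img_curve, hD.img_curve] at hp
  obtain ⟨k, hk, rfl⟩ := h.exists_of_mem hC hD hp.1 hp.2
  rw [common, List.mem_filter, List.mem_range] at hk
  refine ⟨C.code k, ?_, rfl⟩
  rw [Nat.testBit_and, hk.2, testBit_mask.2 ⟨k, hk.1, rfl⟩]
  rfl

end GridCurve

/-- The boundary of a rectangle. -/
def sweepCurve : GridCurve :=
  ⟨68, 55386381327078899437463897253275743297125759577926766878971681756903953555599088055471532237597741597396147121377521363147153467172660310573413254980212191472512824754385425650587546928152965384722656545149841297374408417542981706900470289433031,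
    25768742829814688622800781054106479422032201087465109333343386662860165110493839687740310255648035268970100849524117078117879753114472313482411826216224960231400003893353480643703436449525954190984569713657118725197750386779830102306363388354455399407572198467230631031524467412041623572422243755335246838214291710384737287772216625581537706004855799358587509745947637877466217020524603292646054879486662871613440⟩

/-- The first member of a pair of curves exchanged by a half turn of the rectangle. -/
def hookTop : GridCurve :=
  ⟨72, 37336481691442647682370513962094626411725555636469673444057520076213235833508932154400345552586699751876999082987237814875008189508008653779479667907022943202538332518581495067014496713143223050852923233710479200975522992282245383549604565664185092923250291867,
    1294026476586032794936791634075719884471446267401575174869251018752632686269820626395824303879942206027345806750176134861518923801640113324965873937404306200658829944255312720999071281778601808958315141553758966721894067361517753212583122240922354039286038243925694045491693180513234768113080528999438014249665468109758967393852460088955393868467104790809083344029520627104963884120792001618748568432681581986754418274225619748355167839752413345253118238597865631253528576⟩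

/-- The curve `hookTop` after a half turn. -/
def hookBottom : GridCurve :=
  ⟨72, 19404168164724458052590127960642736733895323699884602397205996196041614222894034136292349554152577930780167558296928927946732935308371970482235075904674082780956095677899271244428821815056708496049661906627470862086211730868285756045061460878183627530001474246,
    14204896343563580757466237699533153920289173429215232928109069658547587021371472991827673353311934564240053765252312587706624236453271822731395514699591458097129354983392820667817494771720273172341494049179458416418736948477871364205858992788434386419712⟩

/-- The first member of a second pair of curves exchanged by the half turn. -/
def spiralLeft : GridCurve :=
  ⟨146, 91987289968424485240042801258836106460784054989647858804184474029433149733963055055642407893798071571334457717727911035638897582113283678317004210285856561660621392621954527944146103852144680513464558102707692185016175896704450741870839528966600551174014157838766944329829144672667632986060926168529434815384404959218574872209495601940652560372204717135772756932206142451967889657012779504131266358549333335260147390336719196452327849484437428286000586537831306879608630731139855188462594786936491096824825123563426233983485452,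
    47740974049504723515215520645559413472232290587538850686353793972056426842308372172762678919024405430629431280498843006106406353247345953917004398731949935015478800207610878432715340273162360527981507133279724583169880512685630455459184533260369299504790594232980713985929021840219151168244709463940292882521792939056196060057031333385978930223152238770162321240890311313718621954398108220740651324881651055590914129772939244541882610326196463684953394355731956510094646944878953008291905536⟩

/-- The curve `spiralLeft` after a half turn. -/
def spiralRight : GridCurve :=
  ⟨146, 25105581172578455474047847221703802704716479046996282525705945232522120190787500354223394623766543702623877601143110526198072233093401618685109809621739986753998561413464118791465972287902779268148825595115865270028013902718085438726192058861047767058159550986286289241185821895364464811374805187991118035792094413160684231918883682206558308597854703498933978399453521502298890241235302932270211424680868018443694195751919640088151665397912154510793712414111678939152760930341952735642325359886721683659735665225657144348594517,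
    1761337772650561165777840137399041363441283787171620562127637729147144604396492968121621971078003334246938498066568777269442307892962440402017989572796385298354527038623950707059481839865967974974950850357005129196362820106059803663558952780620091620573918746364861526638993429076680100933049542652816157915960063751048935674649332227912414508169305658599489027603172007711041907729304798270563097405992364275653761104957948983960345243140522615343361582220255204803417118488115726473782349947294804293141397504⟩

/-- The first member of a third pair of curves exchanged by the half turn. -/
def forkTop : GridCurve :=
  ⟨60, 2004201309983751995085854107285662541926184329448842658381137052878257871126696419323301209583436957593114717200868199281389739317401011333739355635811818918152514364172910338780167726108108674393815004117113327396305,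
    67434805693278333776083150939129115578041651104781435183086417932147597425769516100734072964102526908563570951174373219070209534540499537924284661962091363739598946392118587319283201149762515986150002269889554161212685859141093764059445749425562061877921328889552894473393352751283122173764528925406197406243560223945079270681146465983333393653130830890608055415456201321697022485608339111697763260567887464908021612902870080743933747469039402221568⟩

/-- The curve `forkTop` after a half turn. -/
def forkBottom : GridCurve :=
  ⟨60, 540137426279899777148228330769769975754823158478331269487713225376296389763253198313582488504927980726304004146744394934152703724630181670336956360597598623746797781360347994439508510603352026475279190430123407503760,
    19098638840666729631560810688764061077809597436002741176783112818935246246682219365746134039259109333095724137591824451495024882212875044393486273895148826173764506901420999560905026212840025460217510852426965190244722323263131364719432918308932473823387455048348560388981397326656288055442961781055337482895106501707041774505361706023276263645637138940003462794075299143022366647402620780544⟩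

/-- The two chords of each of the hooks. -/
def hookChords : Chord × Chord :=
  (⟨2, 4, [], 7, 9⟩, ⟨50, 54, [55, 56, 57, 60, 61, 64, 65, 66], 67, 71⟩)

/-- The two chords of each of the spirals. -/
def spiralChords : Chord × Chord :=
  (⟨90, 92, [], 95, 97⟩, ⟨116, 120, [123, 126, 128, 133, 135, 138], 141, 145⟩)

/-- The two chords of each of the forks. -/
def forkChords : Chord × Chord :=
  (⟨1, 3, [], 6, 8⟩, ⟨16, 20, [25, 28, 29, 30, 31, 34, 39, 42, 43, 46], 55, 59⟩)

/-- The curves of the family; the first one is swept. -/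
def gridCurves : Fin 7 → GridCurve :=
  ![sweepCurve, hookTop, hookBottom, spiralLeft, spiralRight, forkTop, forkBottom]

/-- The chords which the curves other than the first one have in the inside of the first one. -/
def gridChords : Fin 6 → Chord × Chord :=
  ![hookChords, hookChords, spiralChords, spiralChords, forkChords, forkChords]

/-- The curves to be met by the swept curve. -/
def gridTrack (i : Fin 6) : Track := (gridCurves i.succ).track (gridChords i)

/-- The list of all tracks. -/
def gridTracks : List Track := (List.finRange 6).map gridTrack

theorem gridCurves_ok : ∀ i, (gridCurves i).Ok := by decide +kernel

theorem gridCurves_compatible :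
    ∀ i j, i ≠ j → GridCurve.Compatible (gridCurves i) (gridCurves j) := by decide +kernel

theorem gridCurves_mask_and : ∀ i j k, i ≠ j → j ≠ k → i ≠ k →
    ((gridCurves i).mask &&& (gridCurves j).mask) &&&
      ((gridCurves i).mask &&& (gridCurves k).mask) = 0 := by decide +kernel

theorem gridTrack_ok : ∀ i, (gridTrack i).Ok := by decide +kernel

theorem gridTrack_endsOutside : ∀ i, GridCurve.EndsOutside sweepCurve.area (gridTrack i) := by
  decide +kernel

theorem verts_gridTracks_ne_nil : verts gridTracks ≠ [] := by decide +kernel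

theorem good_of_mem_verts : ∀ v ∈ verts gridTracks, Good gridTracks v := by decide +kernel

theorem inGrid_of_mem_verts : ∀ v ∈ verts gridTracks, InGrid v ∧
    ∀ d ∈ [0, 1, 64, 65], sweepCurve.area.testBit (v - d) = true := by decide +kernel

theorem exists_mem_verts (i : Fin 6) : ∃ k, (gridCurves i.succ).code k ∈ verts gridTracks :=
  ⟨_, List.mem_flatMap.2 ⟨gridTrack i, List.mem_map.2 ⟨i, List.mem_finRange i, rfl⟩,
    List.mem_map.2 ⟨(gridTrack i).left.first, by simp [Chord.vs], rfl⟩⟩⟩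

theorem testBit_area_centre : sweepCurve.area.testBit 912 = true := by decide +kernel

/-- The members of the family as Jordan curves. -/
def familyCurve (i : Fin 7) : JordanCurve := (gridCurves_ok i).curve

theorem encard_familyCurve_inter_le {i j : Fin 7} (h : i ≠ j) :
    ((familyCurve i).img ∩ (familyCurve j).img).encard ≤ 4 := by
  simp only [familyCurve, GridCurve.Ok.img_curve]
  exact (gridCurves_compatible i j h).encard_le (gridCurves_ok i) (gridCurves_ok j)

theorem generalPosition_familyCurve : GeneralPosition (range familyCurve) := by
  refine ⟨?_, ?_, ?_⟩
  · rintro _ ⟨i, rfl⟩ _ ⟨j, rfl⟩ h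
    exact finite_of_encard_le_coe (k := 4) (encard_familyCurve_inter_le (ne_of_apply_ne _ h))
  · rintro _ ⟨i, rfl⟩ _ ⟨j, rfl⟩ h p hp
    exact (gridCurves_compatible i j (ne_of_apply_ne _ h)).isCrossing _ _ hp
  · rintro _ ⟨i, rfl⟩ _ ⟨j, rfl⟩ _ ⟨k, rfl⟩ p hi hj hk
    by_contra! h
    have hij : i ≠ j := ne_of_apply_ne _ h.1
    have hjk : j ≠ k := ne_of_apply_ne _ h.2.1
    have hik : i ≠ k := ne_of_apply_ne _ h.2.2
    obtain ⟨a, ha, rfl⟩ := (gridCurves_compatible i j hij).testBit_mask_and _ _ ⟨hi, hj⟩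
    obtain ⟨b, hb, hab⟩ := (gridCurves_compatible i k hik).testBit_mask_and _ _ ⟨hi, hk⟩
    obtain rfl := latticePt_injective hab
    have := Nat.testBit_and _ _ a ▸
      congrArg (Nat.testBit · a) (gridCurves_mask_and i j k hij hjk hik)
    simp [ha, hb] at this

theorem latticePt_mem_inside_of_mem_verts {v : ℕ} (hv : v ∈ verts gridTracks) :
    latticePt v ∈ (familyCurve 0).inside :=
  (gridCurves_ok 0).latticePt_mem_inside (inGrid_of_mem_verts v hv).1 (inGrid_of_mem_verts v hv).2

theorem familyCurve_succ_ne (i : Fin 6) : familyCurve i.succ ≠ familyCurve 0 := by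
  obtain ⟨k, hk⟩ := exists_mem_verts i
  intro h
  refine (latticePt_mem_inside_of_mem_verts hk).1 ?_
  change _ ∈ (familyCurve 0).img
  rw [← h, familyCurve, GridCurve.Ok.img_curve]
  exact (gridCurves_ok i.succ).latticePt_mem_points k

theorem exists_six_of_isSweep_familyCurve {P : Plane} (hP : ∀ a, latticePt a ≠ P)
    {F : ℝ → unitCircle → Plane} (hF : IsSweep (familyCurve 0) P F) :
    ∃ t ∈ Ico (0 : ℝ) 1, ∃ i : Fin 6,
      6 ≤ (range (F t) ∩ (familyCurve i.succ).img).encard := by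
  obtain ⟨t, ht, τ, hτ, h6⟩ := hF.exists_six (T := gridTracks) (L := latticePt)
    (c := fun τ => polyline τ.n τ.code)
    (by
      intro τ hτ
      obtain ⟨i, -, rfl⟩ := List.mem_map.1 hτ
      exact (gridCurves_ok 0).realizes (gridCurves_ok i.succ) (gridTrack_ok i)
        (gridTrack_endsOutside i))
    verts_gridTracks_ne_nil
    (fun v hv => ⟨latticePt_mem_inside_of_mem_verts hv, hP v⟩) good_of_mem_verts
  obtain ⟨i, -, rfl⟩ := List.mem_map.1 hτ
  refine ⟨t, ht, i, ?_⟩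
  rw [familyCurve, GridCurve.Ok.img_curve]
  exact h6

/-- There is a non-piercing, 4-intersecting family in general position, with a sweep curve `γ`
and point `P ∈ γ̃`, such that every sweep of the family by `γ` to `P` must at some time meet
some other curve of the family in at least six points. -/
theorem no_4intersecting_sweep :
    ∃ Γ : Set JordanCurve, Γ.Finite ∧ GeneralPosition Γ ∧ NonPiercingFamily Γ ∧
      (∀ α ∈ Γ, ∀ β ∈ Γ, α ≠ β → (α.img ∩ β.img).encard ≤ 4) ∧
      ∃ γ ∈ Γ, ∃ P ∈ γ.inside, (∀ α ∈ Γ, P ∉ α.img) ∧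
        ∀ F : ℝ → unitCircle → Plane, IsSweep γ P F →
          ∃ t ∈ Set.Ico (0:ℝ) 1, ∃ α ∈ Γ, α ≠ γ ∧
            6 ≤ (Set.range (F t) ∩ α.img).encard := by
  refine ⟨range familyCurve, finite_range _, generalPosition_familyCurve, ?_, ?_,
    familyCurve 0, mem_range_self 0, centre (cellOf 912), ?_, ?_, ?_⟩
  · rintro _ ⟨i, rfl⟩ _ ⟨j, rfl⟩ h
    have hij : i ≠ j := ne_of_apply_ne _ h
    exact ⟨(gridCurves_compatible i j hij).pathConn _ _,
      (gridCurves_compatible j i hij.symm).pathConn _ _⟩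
  · rintro _ ⟨i, rfl⟩ _ ⟨j, rfl⟩ h
    exact encard_familyCurve_inter_le (ne_of_apply_ne _ h)
  · exact (gridCurves_ok 0).centre_mem_inside (cellOf_mem_cells.2 testBit_area_centre)
  · rintro _ ⟨i, rfl⟩
    exact (gridCurves_ok i).centre_notMem_img _
  · intro F hF
    obtain ⟨t, ht, i, h⟩ :=
      exists_six_of_isSweep_familyCurve (fun a => GridCurve.latticePt_ne_centre a _) hF
    exact ⟨t, ht, _, mem_range_self i.succ, familyCurve_succ_ne i, h⟩
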